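/- arXiv:1804.00289 — 4 statements merged into one kernel-verified Lean document; each statement's English description precedes it below -/
import Mathlib

section
/- Let H be a finite-dimensional Hopf algebra over a field K of characteristic zero and α a Hopf 2-cocycle on H. The map sending an algebra homomorphism ν : ^αH^{α^{-1}} → K to the linear map x ↦ ν(x₁)x₂ is a group isomorphism from the group of characters of the Hopf algebra ^αH^{α^{-1}} onto the group of H-comodule algebra automorphisms of ^αH. In particular, since ^αH^{α^{-1}} is finite dimensional, the automorphism group of ^αH as an H-comodule algebra is finite. -/
open TensorProduct LinearMap

universe u

section HopfDefs

variable (K : Type u) [Field K]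

/-- Convolution product of two linear maps from a coalgebra `C` to an algebra `A`. -/
noncomputable def convH {C A : Type u} [AddCommGroup C] [Module K C] [Coalgebra K C]
    [Ring A] [Algebra K A] (f g : C →ₗ[K] A) : C →ₗ[K] A :=
  LinearMap.mul' K A ∘ₗ TensorProduct.map f g ∘ₗ Coalgebra.comul

variable (H : Type u) [Ring H] [HopfAlgebra K H]

/-- `x ⊗ y ↦ α(x₁ ⊗ y₁) • x₂ * y₂`, the multiplication of the cocycle deformation `^αH`. -/
noncomputable def aMul (α : H ⊗[K] H →ₗ[K] K) : H ⊗[K] H →ₗ[K] H :=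
  convH K (Algebra.linearMap K H ∘ₗ α) (LinearMap.mul' K H)

/-- `x ⊗ (y ⊗ z) ↦ α(x₁,y₁) α(x₂y₂, z)` -/
noncomputable def cocycleLHS (α : H ⊗[K] H →ₗ[K] K) : H ⊗[K] (H ⊗[K] H) →ₗ[K] K :=
  convH K
    (LinearMap.mul' K K ∘ₗ TensorProduct.map α Coalgebra.counit ∘ₗ
      (TensorProduct.assoc K H H H).symm.toLinearMap)
    (α ∘ₗ TensorProduct.map (LinearMap.mul' K H) LinearMap.id ∘ₗ
      (TensorProduct.assoc K H H H).symm.toLinearMap)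

/-- `x ⊗ (y ⊗ z) ↦ α(y₁,z₁) α(x, y₂z₂)` -/
noncomputable def cocycleRHS (α : H ⊗[K] H →ₗ[K] K) : H ⊗[K] (H ⊗[K] H) →ₗ[K] K :=
  convH K
    (LinearMap.mul' K K ∘ₗ TensorProduct.map Coalgebra.counit α)
    (α ∘ₗ TensorProduct.map LinearMap.id (LinearMap.mul' K H))

/-- A Hopf 2-cocycle on `H`: convolution invertible, satisfying the associativity (cocycle)
condition and the unity condition. -/
structure IsHopfCocycle (α : H ⊗[K] H →ₗ[K] K) : Prop where
  conv_invertible : ∃ β : H ⊗[K] H →ₗ[K] K,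
    convH K α β = Coalgebra.counit ∧ convH K β α = Coalgebra.counit
  cocycle : cocycleLHS K H α = cocycleRHS K H α
  unit_left : ∀ x : H, α (1 ⊗ₜ[K] x) = Coalgebra.counit x
  unit_right : ∀ x : H, α (x ⊗ₜ[K] 1) = Coalgebra.counit x

/-- `γ(x) = α(x₁, S(x₂))`. -/
noncomputable def cocycleGamma (α : H ⊗[K] H →ₗ[K] K) : H →ₗ[K] K :=
  α ∘ₗ TensorProduct.map LinearMap.id (HopfAlgebra.antipode (R := K)) ∘ₗ Coalgebra.comul

/-- The twisted antipode `S̃(x) = γ'(x₂) • S(x₁)`, where `γ'` is the convolution inverse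
of `γ`. -/
noncomputable def tAntipode (γ' : H →ₗ[K] K) : H →ₗ[K] H :=
  convH K (HopfAlgebra.antipode (R := K)) (Algebra.linearMap K H ∘ₗ γ')

/-- `A_f : x ↦ f(x₂) • x₁`, the action of `f ∈ H*` on `^αH`. -/
noncomputable def Af (f : H →ₗ[K] K) : H →ₗ[K] H :=
  convH K LinearMap.id (Algebra.linearMap K H ∘ₗ f)

/-- The map `M : x ⊗ y ↦ (x ·_α y₁) ⊗ y₂`. -/
noncomputable def Mmap (α : H ⊗[K] H →ₗ[K] K) : H ⊗[K] H →ₗ[K] H ⊗[K] H :=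
  TensorProduct.map (aMul K H α) LinearMap.id ∘ₗ
    (TensorProduct.assoc K H H H).symm.toLinearMap ∘ₗ
      TensorProduct.map LinearMap.id Coalgebra.comul

/-- The map `T : x ⊗ h ↦ (x ·_α S̃(h₁)) ⊗ h₂`. -/
noncomputable def Tmap (α : H ⊗[K] H →ₗ[K] K) (γ' : H →ₗ[K] K) :
    H ⊗[K] H →ₗ[K] H ⊗[K] H :=
  TensorProduct.map (aMul K H α) LinearMap.id ∘ₗ
    (TensorProduct.assoc K H H H).symm.toLinearMap ∘ₗ
      TensorProduct.map LinearMap.id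
        (TensorProduct.map (tAntipode K H γ') LinearMap.id ∘ₗ Coalgebra.comul)

/-- `ν ↦ (x ↦ ν(x₁) • x₂)`. -/
noncomputable def nuMap (ν : H →ₗ[K] K) : H →ₗ[K] H :=
  convH K (Algebra.linearMap K H ∘ₗ ν) LinearMap.id

/-- `φ : H →ₗ[K] H` is an isomorphism of `H`-comodule algebras `^αH → ^{α'}H`. -/
noncomputable def IsDeformIso (α α' : H ⊗[K] H →ₗ[K] K) (φ : H →ₗ[K] H) : Prop :=
  Function.Bijective φ ∧ φ 1 = 1 ∧
    φ ∘ₗ aMul K H α = aMul K H α' ∘ₗ TensorProduct.map φ φ ∧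
    Coalgebra.comul ∘ₗ φ = TensorProduct.map φ LinearMap.id ∘ₗ (Coalgebra.comul (A := H))

end HopfDefs

/-- The multiplication of the double-twisted Hopf algebra `^αH^{α⁻¹}`:
`x ⊗ y ↦ α(x₁,y₁) x₂y₂ β(x₃,y₃)` where `β = α⁻¹`. -/
noncomputable def dMul (K H : Type u) [Field K] [Ring H] [HopfAlgebra K H]
    (α β : H ⊗[K] H →ₗ[K] K) : H ⊗[K] H →ₗ[K] H :=
  convH K (aMul K H α) (Algebra.linearMap K H ∘ₗ β)

/-- A character of the Hopf algebra `^αH^{α⁻¹}`, i.e. an algebra homomorphism to `K`. -/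
noncomputable def IsChar (K H : Type u) [Field K] [Ring H] [HopfAlgebra K H]
    (α β : H ⊗[K] H →ₗ[K] K) (ν : H →ₗ[K] K) : Prop :=
  ν 1 = 1 ∧ ∀ x y : H, ν (dMul K H α β (x ⊗ₜ[K] y)) = ν x * ν y

section Regular

variable {K : Type u} [Field K]

section Coalgebra

variable {C : Type u} [AddCommGroup C] [Module K C] [Coalgebra K C]

theorem convH_assoc {A : Type u} [Ring A] [Algebra K A] (f g h : C →ₗ[K] A) :
    convH K (convH K f g) h = convH K f (convH K g h) :=
  congrArg WithConv.ofConv (mul_assoc (WithConv.toConv f) (WithConv.toConv g) (WithConv.toConv h))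

theorem convH_counit (f : C →ₗ[K] K) : convH K f Coalgebra.counit = f :=
  congrArg WithConv.ofConv (mul_one (WithConv.toConv f))

theorem Coalgebra.Repr.convH_apply {ι : Type*} {A : Type u} [Ring A] [Algebra K A] {x : C}
    (r : Coalgebra.Repr K x ι) (f g : C →ₗ[K] A) :
    convH K f g x = ∑ i ∈ r.index, f (r.left i) * g (r.right i) :=
  r.convMul_apply (WithConv.toConv f) (WithConv.toConv g)

/-- The action `x ↦ f(x₁) • x₂` of the dual of a coalgebra. -/
noncomputable def dualAct (f : C →ₗ[K] K) : C →ₗ[K] C :=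
  (TensorProduct.lid K C).toLinearMap ∘ₗ TensorProduct.map f LinearMap.id ∘ₗ Coalgebra.comul

theorem Coalgebra.Repr.dualAct_apply {ι : Type*} {x : C} (r : Coalgebra.Repr K x ι)
    (f : C →ₗ[K] K) : dualAct f x = ∑ i ∈ r.index, f (r.left i) • r.right i := by
  simp [dualAct, ← r.eq]

theorem comp_dualAct {A : Type u} [Ring A] [Algebra K A] (f : C →ₗ[K] K) (g : C →ₗ[K] A) :
    g ∘ₗ dualAct f = convH K (Algebra.linearMap K A ∘ₗ f) g := by
  ext x
  simp [(Coalgebra.Repr.arbitrary K x).dualAct_apply, (Coalgebra.Repr.arbitrary K x).convH_apply,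
    Algebra.smul_def]

theorem functional_comp_dualAct (f g : C →ₗ[K] K) : g ∘ₗ dualAct f = convH K f g :=
  comp_dualAct f g

theorem counit_comp_dualAct (f : C →ₗ[K] K) : Coalgebra.counit ∘ₗ dualAct f = f := by
  rw [functional_comp_dualAct, convH_counit]

theorem dualAct_injective : Function.Injective (dualAct : (C →ₗ[K] K) → C →ₗ[K] C) :=
  fun f g h => by rw [← counit_comp_dualAct f, h, counit_comp_dualAct]

theorem dualAct_counit : dualAct (Coalgebra.counit : C →ₗ[K] K) = LinearMap.id := by
  ext x
  simp [(Coalgebra.Repr.arbitrary K x).dualAct_apply, Coalgebra.sum_counit_smul]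

theorem dualAct_comp_coalgHom {D : Type u} [AddCommGroup D] [Module K D] [Coalgebra K D]
    (h : C →ₗc[K] D) (f : D →ₗ[K] K) :
    dualAct f ∘ₗ h.toLinearMap = h.toLinearMap ∘ₗ dualAct (f ∘ₗ h.toLinearMap) := by
  ext x
  have r := Coalgebra.Repr.arbitrary K x
  have e : Coalgebra.comul (R := K) (h x) = ∑ i ∈ r.index, h (r.left i) ⊗ₜ[K] h (r.right i) := by
    rw [← CoalgHomClass.map_comp_comul_apply, ← r.eq]
    simp
  simp only [LinearMap.comp_apply, r.dualAct_apply, map_sum, map_smul]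
  simp [dualAct, e]

theorem comul_comp_dualAct (f : C →ₗ[K] K) :
    Coalgebra.comul ∘ₗ dualAct f
      = TensorProduct.map (dualAct f) LinearMap.id ∘ₗ (Coalgebra.comul (R := K) (A := C)) := by
  ext x
  let T : C ⊗[K] (C ⊗[K] C) →ₗ[K] C ⊗[K] C :=
    (TensorProduct.lid K (C ⊗[K] C)).toLinearMap ∘ₗ TensorProduct.map f LinearMap.id
  have hT : TensorProduct.map (dualAct f) LinearMap.id
      = T ∘ₗ (TensorProduct.assoc K C C C).toLinearMap ∘ₗ Coalgebra.comul.rTensor C := by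
    refine TensorProduct.ext' fun a c => ?_
    have r := Coalgebra.Repr.arbitrary K a
    simp [T, r.dualAct_apply, ← r.eq, sum_tmul, smul_tmul']
  have hx := congrArg T (Coalgebra.coassoc_apply (R := K) x)
  have r := Coalgebra.Repr.arbitrary K x
  rw [hT]
  refine Eq.trans ?_ hx.symm
  simp [T, r.dualAct_apply, ← r.eq]

theorem dualAct_comp_dualAct (f g : C →ₗ[K] K) :
    dualAct g ∘ₗ dualAct f = dualAct (convH K f g) := by
  rw [← functional_comp_dualAct]
  conv_lhs => rw [dualAct]
  simp only [LinearMap.comp_assoc, comul_comp_dualAct]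
  simp only [dualAct, ← LinearMap.comp_assoc, ← TensorProduct.map_comp, LinearMap.id_comp]

theorem map_dualAct {D : Type u} [AddCommGroup D] [Module K D] [Coalgebra K D]
    (f : C →ₗ[K] K) (g : D →ₗ[K] K) :
    TensorProduct.map (dualAct f) (dualAct g)
      = dualAct (LinearMap.mul' K K ∘ₗ TensorProduct.map f g) := by
  refine TensorProduct.ext' fun x y => ?_
  have r := Coalgebra.Repr.arbitrary K x
  have s := Coalgebra.Repr.arbitrary K y
  have e : Coalgebra.comul (R := K) (x ⊗ₜ[K] y) = ∑ i ∈ r.index, ∑ j ∈ s.index,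
      (r.left i ⊗ₜ[K] s.left j) ⊗ₜ[K] (r.right i ⊗ₜ[K] s.right j) := by
    simp [TensorProduct.comul_tmul, ← r.eq, ← s.eq, sum_tmul, tmul_sum]
    exact Finset.sum_comm
  simp only [map_tmul, r.dualAct_apply, s.dualAct_apply, sum_tmul, tmul_sum, smul_tmul_smul]
  simpa [dualAct, e] using Finset.sum_comm

end Coalgebra

variable {H : Type u} [Ring H] [HopfAlgebra K H]

theorem aMul_eq (α : H ⊗[K] H →ₗ[K] K) : aMul K H α = LinearMap.mul' K H ∘ₗ dualAct α :=
  (comp_dualAct _ _).symm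

theorem nuMap_eq (ν : H →ₗ[K] K) : nuMap K H ν = dualAct ν :=
  (comp_dualAct ν LinearMap.id).symm

theorem comp_dMul (α β : H ⊗[K] H →ₗ[K] K) (ν : H →ₗ[K] K) :
    ν ∘ₗ dMul K H α β = convH K (convH K α (ν ∘ₗ LinearMap.mul' K H)) β := by
  rw [← functional_comp_dualAct α, LinearMap.comp_assoc, ← aMul_eq]
  refine LinearMap.ext fun x => ?_
  have r := Coalgebra.Repr.arbitrary K x
  rw [LinearMap.comp_apply, dMul, r.convH_apply, r.convH_apply, map_sum]
  refine Finset.sum_congr rfl fun i _ => ?_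
  rw [LinearMap.comp_apply, Algebra.linearMap_apply, ← Algebra.commutes, ← Algebra.smul_def,
    map_smul, smul_eq_mul, mul_comm, LinearMap.comp_apply]

theorem dualAct_comp_mul' (ν : H →ₗ[K] K) :
    dualAct ν ∘ₗ LinearMap.mul' K H
      = LinearMap.mul' K H ∘ₗ dualAct (ν ∘ₗ LinearMap.mul' K H) :=
  dualAct_comp_coalgHom (Bialgebra.mulCoalgHom K H) ν

theorem counit_comp_mul' :
    (Coalgebra.counit : H →ₗ[K] K) ∘ₗ LinearMap.mul' K H = Coalgebra.counit :=
  (Bialgebra.mulCoalgHom K H).counit_comp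

theorem isChar_iff {α β : H ⊗[K] H →ₗ[K] K}
    (hβ : convH K α β = Coalgebra.counit ∧ convH K β α = Coalgebra.counit) (ν : H →ₗ[K] K) :
    IsChar K H α β ν ↔ ν 1 = 1 ∧ convH K α (ν ∘ₗ LinearMap.mul' K H)
      = convH K (LinearMap.mul' K K ∘ₗ TensorProduct.map ν ν) α := by
  have key : (∀ x y : H, ν (dMul K H α β (x ⊗ₜ[K] y)) = ν x * ν y) ↔
      convH K (convH K α (ν ∘ₗ LinearMap.mul' K H)) β
        = LinearMap.mul' K K ∘ₗ TensorProduct.map ν ν := by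
    rw [← comp_dMul]
    exact ⟨fun h => TensorProduct.ext' h, fun h x y => LinearMap.congr_fun h (x ⊗ₜ[K] y)⟩
  rw [IsChar, key]
  refine and_congr_right fun _ => ⟨fun h => ?_, fun h => ?_⟩
  · rw [← h, convH_assoc, hβ.2, convH_counit]
  · rw [h, convH_assoc, hβ.1, convH_counit]

theorem dualAct_comp_aMul_iff (α : H ⊗[K] H →ₗ[K] K) (ν : H →ₗ[K] K) :
    dualAct ν ∘ₗ aMul K H α = aMul K H α ∘ₗ TensorProduct.map (dualAct ν) (dualAct ν) ↔
      convH K α (ν ∘ₗ LinearMap.mul' K H)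
        = convH K (LinearMap.mul' K K ∘ₗ TensorProduct.map ν ν) α := by
  rw [aMul_eq, ← LinearMap.comp_assoc, dualAct_comp_mul', map_dualAct, LinearMap.comp_assoc,
    LinearMap.comp_assoc, dualAct_comp_dualAct, dualAct_comp_dualAct]
  refine ⟨fun h => ?_, fun h => by rw [h]⟩
  have := congrArg ((Coalgebra.counit : H →ₗ[K] K) ∘ₗ ·) h
  simpa only [← LinearMap.comp_assoc, counit_comp_mul', counit_comp_dualAct] using this

/-- `x ⊗ y ↦ x f(y₁) ⊗ y₂`. -/
noncomputable def mulRightAct (f : H →ₗ[K] H) : H ⊗[K] H →ₗ[K] H ⊗[K] H :=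
  TensorProduct.map (LinearMap.mul' K H ∘ₗ TensorProduct.map LinearMap.id f) LinearMap.id ∘ₗ
    (TensorProduct.assoc K H H H).symm.toLinearMap ∘ₗ
      TensorProduct.map LinearMap.id Coalgebra.comul

theorem mulRightAct_tmul (f : H →ₗ[K] H) (x y : H) :
    mulRightAct f (x ⊗ₜ[K] y)
      = (x ⊗ₜ 1) * TensorProduct.map f LinearMap.id (Coalgebra.comul (R := K) y) := by
  have r := Coalgebra.Repr.arbitrary K y
  simp [mulRightAct, ← r.eq, tmul_sum, Finset.mul_sum]

theorem mulRightAct_comp (f g : H →ₗ[K] H) :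
    mulRightAct f ∘ₗ mulRightAct g = mulRightAct (K := K) (convH K g f) := by
  let T : H ⊗[K] (H ⊗[K] H) →ₗ[K] H ⊗[K] H :=
    TensorProduct.map (LinearMap.mul' K H) LinearMap.id ∘ₗ
      (TensorProduct.assoc K H H H).symm.toLinearMap ∘ₗ
        TensorProduct.map g (TensorProduct.map f LinearMap.id)
  have hT : TensorProduct.map (convH K g f) LinearMap.id
      = T ∘ₗ (TensorProduct.assoc K H H H).toLinearMap ∘ₗ Coalgebra.comul.rTensor H := by
    refine TensorProduct.ext' fun a c => ?_
    have r := Coalgebra.Repr.arbitrary K a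
    simp [T, r.convH_apply, ← r.eq, sum_tmul]
  refine TensorProduct.ext' fun x y => ?_
  have hy := congrArg T (Coalgebra.coassoc_apply (R := K) y)
  have r := Coalgebra.Repr.arbitrary K y
  rw [mulRightAct_tmul (convH K g f), hT]
  refine Eq.trans ?_ (congrArg ((x ⊗ₜ[K] 1) * ·) hy.symm)
  rw [LinearMap.comp_apply, mulRightAct_tmul, ← r.eq]
  simp only [map_sum, Finset.mul_sum, TensorProduct.map_tmul, Algebra.TensorProduct.tmul_mul_tmul,
    LinearMap.id_apply, one_mul, mulRightAct_tmul, LinearMap.lTensor_tmul]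
  refine Finset.sum_congr rfl fun i _ => ?_
  have s := Coalgebra.Repr.arbitrary K (r.right i)
  simp [T, ← s.eq, tmul_sum, Finset.mul_sum, mul_assoc]

theorem mulRightAct_one :
    mulRightAct (Algebra.linearMap K H ∘ₗ Coalgebra.counit) = LinearMap.id := by
  refine TensorProduct.ext' fun x y => ?_
  have h := Coalgebra.rTensor_counit_comul (R := K) y
  have := congrArg (TensorProduct.map (Algebra.linearMap K H) LinearMap.id) h
  rw [LinearMap.rTensor, ← LinearMap.comp_apply, ← TensorProduct.map_comp,
    LinearMap.id_comp] at this
  rw [mulRightAct_tmul, this]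
  simp

theorem mulRightAct_id_injective :
    Function.Injective (mulRightAct (LinearMap.id : H →ₗ[K] H)) := by
  have h : mulRightAct (HopfAlgebra.antipode K) ∘ₗ mulRightAct (LinearMap.id : H →ₗ[K] H)
      = LinearMap.id := by
    rw [mulRightAct_comp, ← mulRightAct_one]
    exact congrArg (fun f => mulRightAct (WithConv.ofConv f)) (LinearMap.id_mul_antipode (R := K))
  exact LinearMap.injective_of_comp_eq_id _ _ h

theorem Mmap_eq (α : H ⊗[K] H →ₗ[K] K) : Mmap K H α = mulRightAct LinearMap.id ∘ₗ dualAct α := by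
  refine TensorProduct.ext' fun x y => ?_
  have r := Coalgebra.Repr.arbitrary K x
  have hα (z : H) : dualAct α (x ⊗ₜ[K] z) = ∑ i ∈ r.index,
      r.right i ⊗ₜ[K] dualAct (α ∘ₗ TensorProduct.mk K H H (r.left i)) z := by
    have s := Coalgebra.Repr.arbitrary K z
    simp only [s.dualAct_apply]
    simp [dualAct, TensorProduct.comul_tmul, ← r.eq, ← s.eq, sum_tmul, tmul_sum]
    exact Finset.sum_comm
  have s := Coalgebra.Repr.arbitrary K y
  have hc (f : H →ₗ[K] K) : Coalgebra.comul (R := K) (dualAct f y) = _ :=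
    LinearMap.congr_fun (comul_comp_dualAct f) y
  simp [hα, hc, mulRightAct_tmul, Mmap, aMul_eq, ← s.eq, tmul_sum, sum_tmul, Finset.mul_sum]
  exact Finset.sum_comm

theorem Mmap_injective {α β : H ⊗[K] H →ₗ[K] K} (h : convH K α β = Coalgebra.counit) :
    Function.Injective (Mmap K H α) := by
  have hβ : dualAct β ∘ₗ dualAct α = LinearMap.id := by
    rw [dualAct_comp_dualAct, h, dualAct_counit]
  rw [Mmap_eq, LinearMap.coe_comp]
  exact mulRightAct_id_injective.comp (LinearMap.injective_of_comp_eq_id _ _ hβ)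

theorem map_id_comp_Mmap {α : H ⊗[K] H →ₗ[K] K} {φ : H →ₗ[K] H}
    (hmul : φ ∘ₗ aMul K H α = aMul K H α ∘ₗ TensorProduct.map φ φ)
    (hcomul : Coalgebra.comul ∘ₗ φ = TensorProduct.map φ LinearMap.id ∘ₗ Coalgebra.comul) :
    TensorProduct.map φ LinearMap.id ∘ₗ Mmap K H α = Mmap K H α ∘ₗ TensorProduct.map φ φ := by
  refine TensorProduct.ext' fun x y => ?_
  have r := Coalgebra.Repr.arbitrary K y
  have hm (a b : H) : φ (aMul K H α (a ⊗ₜ b)) = aMul K H α (φ a ⊗ₜ φ b) :=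
    LinearMap.congr_fun hmul (a ⊗ₜ b)
  have hc : Coalgebra.comul (R := K) (φ y) = _ := LinearMap.congr_fun hcomul y
  simp [Mmap, hc, ← r.eq, tmul_sum, hm]

/-- A comodule algebra endomorphism of a cocycle deformation is bijective. -/
theorem bijective_of_comodule_algebra_endomorphism [FiniteDimensional K H]
    {α β : H ⊗[K] H →ₗ[K] K} (h : convH K α β = Coalgebra.counit) {φ : H →ₗ[K] H} (h1 : φ 1 = 1)
    (hmul : φ ∘ₗ aMul K H α = aMul K H α ∘ₗ TensorProduct.map φ φ)
    (hcomul : Coalgebra.comul ∘ₗ φ = TensorProduct.map φ LinearMap.id ∘ₗ Coalgebra.comul) :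
    Function.Bijective φ := by
  have hM := Mmap_injective h
  have hcomm := map_id_comp_Mmap hmul hcomul
  let P : H ⊗[K] H →ₗ[K] H ⊗[K] H := TensorProduct.map φ LinearMap.id
  have hstable : LinearMap.ker P ≤ (LinearMap.ker P).comap (Mmap K H α) := fun t ht => by
    have hsplit : TensorProduct.map φ φ = TensorProduct.map LinearMap.id φ ∘ₗ P := by
      rw [← TensorProduct.map_comp, LinearMap.id_comp, LinearMap.comp_id]
    have := LinearMap.congr_fun hcomm t
    rw [hsplit] at this
    simpa [P, LinearMap.mem_ker.1 ht] using this
  have hsurj : Function.Surjective ((Mmap K H α).restrict hstable) :=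
    LinearMap.surjective_of_injective fun s t hst => Subtype.ext (hM (congrArg Subtype.val hst))
  have hinj : Function.Injective φ := (injective_iff_map_eq_zero φ).2 fun a ha => by
    have hmem : Mmap K H α (1 ⊗ₜ a) ∈ LinearMap.ker P := by
      have := LinearMap.congr_fun hcomm (1 ⊗ₜ a)
      simpa [P, ha] using this
    obtain ⟨t, ht⟩ := hsurj ⟨_, hmem⟩
    have hP : P (1 ⊗ₜ a) = 0 := by
      rw [← hM (congrArg Subtype.val ht)]
      exact t.2
    have := congrArg
      ((TensorProduct.lid K H).toLinearMap ∘ₗ TensorProduct.map Coalgebra.counit LinearMap.id) hP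
    simpa [P, h1] using this
  exact ⟨hinj, LinearMap.surjective_of_injective hinj⟩

end Regular

/-- The unital functionals that are multiplicative for a bilinear product on a finite-dimensional
space are finite in number. -/
theorem finite_setOf_multiplicative {K V : Type*} [Field K] [AddCommGroup V] [Module K V]
    [FiniteDimensional K V] (m : V → V → V) (e : V) :
    {ν : V →ₗ[K] K | ν e = 1 ∧ ∀ x y, ν (m x y) = ν x * ν y}.Finite := by
  let _ : Mul V := ⟨m⟩
  let S := {ν : V →ₗ[K] K | ν e = 1 ∧ ∀ x y, ν (m x y) = ν x * ν y}
  let F : S → (WithOne V →* K) := fun ν => WithOne.lift ⟨ν.1, ν.2.2⟩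
  let E : (V →ₗ[K] K) →ₗ[K] (WithOne V → K) :=
    { toFun := fun ν x => WithOne.recOneCoe (ν e) ν x
      map_add' := fun f g => by ext x; induction x using WithOne.recOneCoe <;> simp
      map_smul' := fun c f => by ext x; induction x using WithOne.recOneCoe <;> simp }
  have hF : Function.Injective F := fun f g h => by
    refine Subtype.ext (LinearMap.ext fun x => ?_)
    simpa [F] using DFunLike.congr_fun h (x : WithOne V)
  have hli : LinearIndependent K (fun ν : S => (ν : V →ₗ[K] K)) := by
    refine LinearIndependent.of_comp E ?_
    have hEF : E ∘ (fun ν : S => (ν : V →ₗ[K] K)) = (fun f : WithOne V →* K => (f : _ → K)) ∘ F := by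
      funext ν x
      induction x using WithOne.recOneCoe with
      | one => simpa [E, F] using ν.2.1
      | coe x => simp [E, F]
    rw [hEF]
    exact (linearIndependent_monoidHom (WithOne V) K).comp F hF
  exact hli.setFinite

/-- The map `ν ↦ (x ↦ ν(x₁)x₂)` is a group isomorphism from the group of
characters of `^αH^{α⁻¹}` onto the group of `H`-comodule algebra automorphisms of `^αH`
(note `φ_{ν₁ * ν₂} = φ_{ν₂} ∘ φ_{ν₁}`); in particular the latter group is finite. -/
theorem characters_equiv_comodule_algebra_automorphisms
    (K H : Type u) [Field K] [CharZero K] [Ring H] [HopfAlgebra K H]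
    [FiniteDimensional K H]
    (α β : H ⊗[K] H →ₗ[K] K) (hα : IsHopfCocycle K H α)
    (hβ : convH K α β = Coalgebra.counit ∧ convH K β α = Coalgebra.counit) :
    (∀ ν : H →ₗ[K] K, IsChar K H α β ν → IsDeformIso K H α α (nuMap K H ν)) ∧
    (∀ ν₁ ν₂ : H →ₗ[K] K, IsChar K H α β ν₁ → IsChar K H α β ν₂ →
      nuMap K H ν₁ = nuMap K H ν₂ → ν₁ = ν₂) ∧
    (∀ φ : H →ₗ[K] H, IsDeformIso K H α α φ →
      ∃ ν : H →ₗ[K] K, IsChar K H α β ν ∧ nuMap K H ν = φ) ∧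
    (∀ ν₁ ν₂ : H →ₗ[K] K, IsChar K H α β ν₁ → IsChar K H α β ν₂ →
      nuMap K H (convH K ν₁ ν₂) = nuMap K H ν₂ ∘ₗ nuMap K H ν₁) ∧
    {φ : H →ₗ[K] H | IsDeformIso K H α α φ}.Finite := by
  have hiff (ν : H →ₗ[K] K) : IsChar K H α β ν ↔ ν 1 = 1 ∧ dualAct ν ∘ₗ aMul K H α
      = aMul K H α ∘ₗ TensorProduct.map (dualAct ν) (dualAct ν) := by
    rw [isChar_iff hβ, dualAct_comp_aMul_iff]
  have hone (ν : H →ₗ[K] K) : dualAct ν 1 = algebraMap K H (ν 1) := by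
    simp [dualAct, Algebra.TensorProduct.one_def, Algebra.algebraMap_eq_smul_one]
  have hsurj : ∀ φ : H →ₗ[K] H, IsDeformIso K H α α φ →
      ∃ ν : H →ₗ[K] K, IsChar K H α β ν ∧ nuMap K H ν = φ := by
    rintro φ ⟨-, h1, hmul, hcomul⟩
    have hφ : dualAct (Coalgebra.counit ∘ₗ φ) = φ := by
      have h : dualAct Coalgebra.counit ∘ₗ φ = dualAct (Coalgebra.counit ∘ₗ φ) := by
        rw [dualAct, LinearMap.comp_assoc, LinearMap.comp_assoc, hcomul, dualAct,
          ← LinearMap.comp_assoc Coalgebra.comul, ← TensorProduct.map_comp,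
          LinearMap.id_comp]
      rw [← h, dualAct_counit, LinearMap.id_comp]
    refine ⟨Coalgebra.counit ∘ₗ φ, (hiff _).2 ⟨by simp [h1], by rwa [hφ]⟩, by rw [nuMap_eq, hφ]⟩
  refine ⟨fun ν hν => ?_, fun ν₁ ν₂ _ _ h => ?_, hsurj, fun ν₁ ν₂ _ _ => ?_, ?_⟩
  · obtain ⟨h1, hmul⟩ := (hiff ν).1 hν
    have hφ1 : dualAct ν 1 = 1 := by rw [hone, h1, map_one]
    rw [nuMap_eq]
    exact ⟨bijective_of_comodule_algebra_endomorphism hβ.1 hφ1 hmul (comul_comp_dualAct ν), hφ1,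
      hmul, comul_comp_dualAct ν⟩
  · rw [nuMap_eq, nuMap_eq] at h
    exact dualAct_injective h
  · simp only [nuMap_eq, dualAct_comp_dualAct]
  · refine ((finite_setOf_multiplicative (K := K) (fun x y => dMul K H α β (x ⊗ₜ[K] y)) 1).image
      (nuMap K H)).subset fun φ hφ => ?_
    obtain ⟨ν, hν, rfl⟩ := hsurj φ hφ
    exact ⟨ν, hν, rfl⟩
end

section
/- Let H be a finite-dimensional Hopf algebra over a field K of characteristic zero and α a Hopf 2-cocycle on H. The linear map T̃ : H → ^αH ⊗ ^αH given by T̃(h) = S̃(h₁) ⊗ h₂ is an algebra homomorphism from H to (^αH)^op ⊗ ^αH; that is, T̃(1) = 1 ⊗ 1 and, writing the product on ^αH ⊗ ^αH by (a ⊗ b)(c ⊗ d) = (c ·_α a) ⊗ (b ·_α d), one has T̃(xy) = T̃(x)T̃(y) for all x, y ∈ H. -/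
open TensorProduct LinearMap

universe u

/-- The multiplication of `(^αH)^op ⊗ ^αH`: `(a ⊗ b)(c ⊗ d) = (c ·_α a) ⊗ (b ·_α d)`. -/
noncomputable def opMulA (K H : Type u) [Field K] [Ring H] [HopfAlgebra K H]
    (α : H ⊗[K] H →ₗ[K] K) : (H ⊗[K] H) ⊗[K] (H ⊗[K] H) →ₗ[K] H ⊗[K] H :=
  TensorProduct.map (aMul K H α) (aMul K H α) ∘ₗ
    TensorProduct.map (TensorProduct.comm K H H).toLinearMap LinearMap.id ∘ₗ
      (TensorProduct.tensorTensorTensorComm K H H H H).toLinearMap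

section Helpers

open Coalgebra HopfAlgebra

variable {K : Type u} [Field K]

section ScalarConvolution

variable {C D : Type u} [AddCommGroup C] [Module K C] [Coalgebra K C]
  [AddCommGroup D] [Module K D] [Coalgebra K D]
  {M N : Type u} [AddCommGroup M] [Module K M] [AddCommGroup N] [Module K N]

/-- `x ↦ φ(x₁) • f(x₂)`, the left action of functionals on linear maps out of a coalgebra. -/
noncomputable def convSMul (φ : C →ₗ[K] K) (f : C →ₗ[K] M) : C →ₗ[K] M :=
  (TensorProduct.lid K M).toLinearMap ∘ₗ TensorProduct.map φ f ∘ₗ comul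

lemma convSMul_repr {ι : Type*} (φ : C →ₗ[K] K) (f : C →ₗ[K] M) {c : C} (r : Repr K c ι) :
    convSMul φ f c = ∑ i ∈ r.index, φ (r.left i) • f (r.right i) := by
  simp [convSMul, ← r.eq]

lemma comp_convSMul (L : M →ₗ[K] N) (φ : C →ₗ[K] K) (f : C →ₗ[K] M) :
    L ∘ₗ convSMul φ f = convSMul φ (L ∘ₗ f) := by
  ext c
  simp [convSMul_repr _ _ (ℛ K c)]

lemma convSMul_counit (f : C →ₗ[K] M) : convSMul counit f = f := by
  ext c
  simp only [convSMul_repr _ _ (ℛ K c), ← map_smul, ← map_sum, sum_counit_smul]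

lemma convSMul_convSMul (φ ψ : C →ₗ[K] K) (f : C →ₗ[K] M) :
    convSMul φ (convSMul ψ f) = convSMul (convH K φ ψ) f := by
  have h : (TensorProduct.lid K M).toLinearMap ∘ₗ
      TensorProduct.map φ ((TensorProduct.lid K M).toLinearMap ∘ₗ TensorProduct.map ψ f) ∘ₗ
        (TensorProduct.assoc K C C C).toLinearMap =
      (TensorProduct.lid K M).toLinearMap ∘ₗ
        TensorProduct.map (LinearMap.mul' K K ∘ₗ TensorProduct.map φ ψ) f := by
    ext a b c
    simp [smul_smul, mul_comm]
  ext c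
  have h' := congr($h (comul.rTensor C (comul c)))
  simp only [LinearMap.comp_apply, LinearEquiv.coe_coe, coassoc_apply] at h'
  simpa [convSMul, convH, LinearMap.lTensor, LinearMap.rTensor, TensorProduct.map_map,
    LinearMap.comp_assoc] using h'

lemma convSMul_comp (φ : C →ₗ[K] K) (f : C →ₗ[K] M) (u : D →ₗc[K] C) :
    convSMul φ f ∘ₗ u.toLinearMap =
      convSMul (φ ∘ₗ u.toLinearMap) (f ∘ₗ u.toLinearMap) := by
  simp only [convSMul, LinearMap.comp_assoc, ← u.map_comp_comul, TensorProduct.map_comp]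

lemma map_convSMul (φ : C →ₗ[K] K) (f : C →ₗ[K] M) (ψ : D →ₗ[K] K) (g : D →ₗ[K] N) :
    TensorProduct.map (convSMul φ f) (convSMul ψ g) =
      convSMul (LinearMap.mul' K K ∘ₗ TensorProduct.map φ ψ) (TensorProduct.map f g) := by
  refine TensorProduct.ext' fun c d => ?_
  simp only [TensorProduct.map_tmul, convSMul, LinearMap.comp_apply, TensorProduct.comul_tmul]
  induction comul (R := K) c using TensorProduct.induction_on with
  | zero => simp
  | add s t hs ht => simp only [map_add, TensorProduct.add_tmul, hs, ht]
  | tmul a b =>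
    induction comul (R := K) d using TensorProduct.induction_on with
    | zero => simp
    | add s t hs ht => simp only [map_add, TensorProduct.tmul_add, hs, ht]
    | tmul a' b' => simp [← TensorProduct.smul_tmul', smul_smul, mul_comm]

/-- `Δ ⊗ Δ` after `Δ`, expressed through `x₁ ⊗ ((x₂ ⊗ x₃) ⊗ x₄)`. -/
lemma map_comul_comul :
    TensorProduct.map comul comul ∘ₗ comul (R := K) (A := C) =
      (TensorProduct.assoc K C C (C ⊗[K] C)).symm.toLinearMap ∘ₗ
        (TensorProduct.assoc K C C C).toLinearMap.lTensor C ∘ₗ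
          (comul.rTensor C ∘ₗ comul).lTensor C ∘ₗ comul := by
  have h : (TensorProduct.assoc K C C (C ⊗[K] C)).symm.toLinearMap ∘ₗ
      ((comul (R := K) (A := C)).lTensor C).lTensor C ∘ₗ
        (TensorProduct.assoc K C C C).toLinearMap =
      TensorProduct.map LinearMap.id comul := by
    refine TensorProduct.ext_threefold fun a b c => ?_
    simp only [LinearMap.comp_apply, LinearEquiv.coe_coe, TensorProduct.assoc_tmul,
      LinearMap.lTensor_tmul, TensorProduct.map_tmul, LinearMap.id_apply]
    induction comul (R := K) c using TensorProduct.induction_on with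
    | zero => simp
    | tmul c d => simp
    | add s t hs ht => simp only [TensorProduct.tmul_add, map_add, hs, ht]
  calc TensorProduct.map comul comul ∘ₗ comul (R := K) (A := C)
      = TensorProduct.map LinearMap.id comul ∘ₗ comul.rTensor C ∘ₗ comul := by
        rw [LinearMap.rTensor, ← LinearMap.comp_assoc, ← TensorProduct.map_comp,
          LinearMap.id_comp, LinearMap.comp_id]
    _ = (TensorProduct.assoc K C C (C ⊗[K] C)).symm.toLinearMap ∘ₗ
        ((comul (R := K) (A := C)).lTensor C).lTensor C ∘ₗ comul.lTensor C ∘ₗ comul := by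
        rw [← h, ← coassoc]
        simp only [LinearMap.comp_assoc]
    _ = _ := by
        rw [← LinearMap.comp_assoc _ _ (LinearMap.lTensor C (LinearMap.lTensor C comul)),
          ← LinearMap.lTensor_comp, ← coassoc, LinearMap.lTensor_comp]
        simp only [LinearMap.comp_assoc]

end ScalarConvolution

section HopfCocycle

variable {H : Type u} [Ring H] [HopfAlgebra K H]

lemma comp_map_comul_comul_eq_of_inner {X Z : Type u} [AddCommGroup X] [Module K X]
    [AddCommGroup Z] [Module K Z]
    (t : H ⊗[K] H →ₗ[K] X) (c : H →ₗ[K] X) (hc : t ∘ₗ comul = c)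
    (Φ : (H ⊗[K] H) ⊗[K] (H ⊗[K] H) →ₗ[K] Z) (Ψ : H ⊗[K] (X ⊗[K] H) →ₗ[K] Z)
    (h : ∀ a b c d : H, Φ ((a ⊗ₜ b) ⊗ₜ (c ⊗ₜ d)) = Ψ (a ⊗ₜ (t (b ⊗ₜ c) ⊗ₜ d))) :
    Φ ∘ₗ TensorProduct.map comul comul ∘ₗ comul =
      Ψ ∘ₗ (c.rTensor H ∘ₗ comul).lTensor H ∘ₗ comul := by
  have hΦ : Φ ∘ₗ (TensorProduct.assoc K H H (H ⊗[K] H)).symm.toLinearMap ∘ₗ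
        (TensorProduct.assoc K H H H).toLinearMap.lTensor H =
      Ψ ∘ₗ (t.rTensor H).lTensor H := by
    ext a b c d
    simpa using h a b c d
  calc Φ ∘ₗ TensorProduct.map comul comul ∘ₗ comul
      = (Φ ∘ₗ (TensorProduct.assoc K H H (H ⊗[K] H)).symm.toLinearMap ∘ₗ
        (TensorProduct.assoc K H H H).toLinearMap.lTensor H) ∘ₗ
          (comul.rTensor H ∘ₗ comul).lTensor H ∘ₗ comul := by
        rw [map_comul_comul]
        simp only [LinearMap.comp_assoc]
    _ = _ := by
        rw [hΦ, ← hc, LinearMap.rTensor_comp]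
        simp only [LinearMap.lTensor_comp, LinearMap.comp_assoc]

lemma rTensor_linearMap_counit_comul :
    (Algebra.linearMap K H ∘ₗ counit).rTensor H ∘ₗ comul = TensorProduct.mk K H H 1 := by
  ext x
  rw [LinearMap.rTensor_comp, LinearMap.comp_assoc, rTensor_counit_comp_comul]
  simp

lemma mul'_map_antipode_id_comul :
    (LinearMap.mul' K H ∘ₗ TensorProduct.map (antipode K) LinearMap.id) ∘ₗ comul =
      Algebra.linearMap K H ∘ₗ counit := by
  rw [LinearMap.comp_assoc]
  exact HopfAlgebra.mul_antipode_rTensor_comul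

/-- The antipode reverses the comultiplication. -/
lemma comul_comp_antipode :
    comul ∘ₗ antipode K (A := H) =
      TensorProduct.map (antipode K) (antipode K) ∘ₗ
        (TensorProduct.comm K H H).toLinearMap ∘ₗ comul := by
  set G : H →ₗ[K] H ⊗[K] H := TensorProduct.map (antipode K) (antipode K) ∘ₗ
        (TensorProduct.comm K H H).toLinearMap ∘ₗ comul with hG
  have hinv : WithConv.toConv G * WithConv.toConv comul = 1 := by
    have key := comp_map_comul_comul_eq_of_inner
      (Z := H ⊗[K] H) (LinearMap.mul' K H ∘ₗ (antipode K).rTensor H) _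
      mul'_map_antipode_id_comul
      (LinearMap.mul' K (H ⊗[K] H) ∘ₗ TensorProduct.map
        (TensorProduct.map (antipode K) (antipode K) ∘ₗ
          (TensorProduct.comm K H H).toLinearMap) LinearMap.id)
      (TensorProduct.map LinearMap.id (LinearMap.mul' K H) ∘ₗ
        (TensorProduct.leftComm K H H H).toLinearMap ∘ₗ
          (antipode K).rTensor (H ⊗[K] H))
      (fun a b c d => by simp)
    have hΨ : (TensorProduct.map LinearMap.id (LinearMap.mul' K H) ∘ₗ
        (TensorProduct.leftComm K H H H).toLinearMap ∘ₗ
          (antipode K).rTensor (H ⊗[K] H)) ∘ₗ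
            (TensorProduct.mk K H H 1).lTensor H =
        TensorProduct.mk K H H 1 ∘ₗ LinearMap.mul' K H ∘ₗ (antipode K).rTensor H := by
      ext a b
      simp
    have hG' : TensorProduct.map G (comul (A := H)) =
        TensorProduct.map (TensorProduct.map (antipode K) (antipode K) ∘ₗ
          (TensorProduct.comm K H H).toLinearMap) LinearMap.id ∘ₗ
            TensorProduct.map comul comul := by
      rw [← TensorProduct.map_comp, LinearMap.id_comp, LinearMap.comp_assoc]
    rw [rTensor_linearMap_counit_comul, ← LinearMap.comp_assoc _ (LinearMap.lTensor _ _), hΨ,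
      LinearMap.comp_assoc, LinearMap.comp_assoc, LinearMap.comp_assoc,
      HopfAlgebra.mul_antipode_rTensor_comul, ← LinearMap.comp_assoc (comul (A := H)), ← hG'] at key
    apply WithConv.ext
    refine key.trans ?_
    ext x
    simp [Algebra.algebraMap_eq_smul_one, Algebra.TensorProduct.one_def]
  exact (congrArg WithConv.ofConv (left_inv_eq_right_inv hinv LinearMap.comul_right_inv)).symm

lemma aMul_eq_convSMul (α : H ⊗[K] H →ₗ[K] K) :
    aMul K H α = convSMul α (LinearMap.mul' K H) := by
  have h : LinearMap.mul' K H ∘ₗ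
      TensorProduct.map (Algebra.linearMap K H ∘ₗ α) (LinearMap.mul' K H) =
      (TensorProduct.lid K H).toLinearMap ∘ₗ TensorProduct.map α (LinearMap.mul' K H) := by
    refine TensorProduct.ext' fun s t => ?_
    simp [Algebra.smul_def]
  rw [aMul, convH, convSMul, ← LinearMap.comp_assoc, h, LinearMap.comp_assoc]

lemma aMul_one_left {α : H ⊗[K] H →ₗ[K] K} (hα : IsHopfCocycle K H α) (x : H) :
    aMul K H α (1 ⊗ₜ x) = x := by
  have h (t : H ⊗[K] H) : TensorProduct.lid K H (TensorProduct.map α (LinearMap.mul' K H)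
      (TensorProduct.tensorTensorTensorComm K H H H H ((1 ⊗ₜ 1) ⊗ₜ t))) =
        TensorProduct.lid K H (counit.rTensor H t) := by
    induction t using TensorProduct.induction_on with
    | zero => simp
    | tmul a b => simp [hα.unit_left]
    | add s t hs ht => simp only [map_add, TensorProduct.tmul_add, hs, ht]
  have h' := h (comul x)
  rw [Coalgebra.rTensor_counit_comul, TensorProduct.lid_tmul, one_smul] at h'
  rw [aMul_eq_convSMul, convSMul, LinearMap.comp_apply, LinearMap.comp_apply,
    TensorProduct.comul_tmul, Bialgebra.comul_one]
  exact h'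

lemma aMul_one_right {α : H ⊗[K] H →ₗ[K] K} (hα : IsHopfCocycle K H α) (x : H) :
    aMul K H α (x ⊗ₜ 1) = x := by
  have h (t : H ⊗[K] H) : TensorProduct.lid K H (TensorProduct.map α (LinearMap.mul' K H)
      (TensorProduct.tensorTensorTensorComm K H H H H (t ⊗ₜ (1 ⊗ₜ 1)))) =
        TensorProduct.lid K H (counit.rTensor H t) := by
    induction t using TensorProduct.induction_on with
    | zero => simp
    | tmul a b => simp [hα.unit_right]
    | add s t hs ht => simp only [map_add, TensorProduct.add_tmul, hs, ht]
  have h' := h (comul x)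
  rw [Coalgebra.rTensor_counit_comul, TensorProduct.lid_tmul, one_smul] at h'
  rw [aMul_eq_convSMul, convSMul, LinearMap.comp_apply, LinearMap.comp_apply,
    TensorProduct.comul_tmul, Bialgebra.comul_one]
  exact h'

/-- The deformed multiplication is associative. -/
lemma aMul_assoc {α : H ⊗[K] H →ₗ[K] K} (hα : IsHopfCocycle K H α) :
    aMul K H α ∘ₗ TensorProduct.map (aMul K H α) LinearMap.id ∘ₗ
        (TensorProduct.assoc K H H H).symm.toLinearMap =
      aMul K H α ∘ₗ TensorProduct.map LinearMap.id (aMul K H α) := by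
  have hmulid : (Coalgebra.TensorProduct.map (Bialgebra.mulCoalgHom K H)
      (CoalgHom.id K H)).toLinearMap = TensorProduct.map (LinearMap.mul' K H) LinearMap.id := rfl
  have hidmul : (Coalgebra.TensorProduct.map (CoalgHom.id K H)
      (Bialgebra.mulCoalgHom K H)).toLinearMap =
        TensorProduct.map LinearMap.id (LinearMap.mul' K H) := rfl
  have hassoc : (Coalgebra.TensorProduct.assoc K K H H H).symm.toCoalgHom.toLinearMap =
      (TensorProduct.assoc K H H H).symm.toLinearMap := rfl
  have hleft : aMul K H α ∘ₗ TensorProduct.map (aMul K H α) LinearMap.id =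
      convSMul (LinearMap.mul' K K ∘ₗ TensorProduct.map α counit)
        (convSMul (α ∘ₗ TensorProduct.map (LinearMap.mul' K H) LinearMap.id)
          (LinearMap.mul' K H ∘ₗ TensorProduct.map (LinearMap.mul' K H) LinearMap.id)) := by
    rw [← hmulid, ← convSMul_comp, ← aMul_eq_convSMul, ← comp_convSMul, hmulid,
      ← map_convSMul, ← aMul_eq_convSMul, convSMul_counit]
  have hright : aMul K H α ∘ₗ TensorProduct.map LinearMap.id (aMul K H α) =
      convSMul (LinearMap.mul' K K ∘ₗ TensorProduct.map counit α)
        (convSMul (α ∘ₗ TensorProduct.map LinearMap.id (LinearMap.mul' K H))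
          (LinearMap.mul' K H ∘ₗ TensorProduct.map LinearMap.id (LinearMap.mul' K H))) := by
    rw [← hidmul, ← convSMul_comp, ← aMul_eq_convSMul, ← comp_convSMul, hidmul,
      ← map_convSMul, ← aMul_eq_convSMul, convSMul_counit]
  have hmul : LinearMap.mul' K H ∘ₗ TensorProduct.map (LinearMap.mul' K H) LinearMap.id ∘ₗ
      (TensorProduct.assoc K H H H).symm.toLinearMap =
        LinearMap.mul' K H ∘ₗ TensorProduct.map LinearMap.id (LinearMap.mul' K H) := by
    ext a b c
    simp [mul_assoc]
  rw [hright, ← LinearMap.comp_assoc, hleft, ← hassoc, convSMul_comp, convSMul_comp, hassoc]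
  simp only [LinearMap.comp_assoc, hmul, convSMul_convSMul]
  exact congrArg (convSMul · _) hα.cocycle

section Deformed

variable {C D : Type u} [AddCommGroup C] [Module K C] [Coalgebra K C]
  [AddCommGroup D] [Module K D] [Coalgebra K D]

/-- The convolution product of maps into the cocycle deformation. -/
noncomputable def deformedConv (α : H ⊗[K] H →ₗ[K] K) (f g : C →ₗ[K] H) : C →ₗ[K] H :=
  aMul K H α ∘ₗ TensorProduct.map f g ∘ₗ comul

lemma deformedConv_repr {ι : Type*} (α : H ⊗[K] H →ₗ[K] K) (f g : C →ₗ[K] H) {c : C}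
    (r : Repr K c ι) :
    deformedConv α f g c =
      ∑ i ∈ r.index, aMul K H α (f (r.left i) ⊗ₜ g (r.right i)) := by
  simp [deformedConv, ← r.eq]

lemma deformedConv_assoc {α : H ⊗[K] H →ₗ[K] K} (hα : IsHopfCocycle K H α)
    (f g h : C →ₗ[K] H) :
    deformedConv α (deformedConv α f g) h = deformedConv α f (deformedConv α g h) := by
  have hfgh : aMul K H α ∘ₗ TensorProduct.map (aMul K H α ∘ₗ TensorProduct.map f g) h =
      (aMul K H α ∘ₗ TensorProduct.map f (aMul K H α ∘ₗ TensorProduct.map g h)) ∘ₗ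
        (TensorProduct.assoc K C C C).toLinearMap := by
    refine TensorProduct.ext_threefold fun a b c => ?_
    simpa using congr($(aMul_assoc hα) (f a ⊗ₜ (g b ⊗ₜ h c)))
  have hl : deformedConv α (deformedConv α f g) h =
      (aMul K H α ∘ₗ TensorProduct.map (aMul K H α ∘ₗ TensorProduct.map f g) h) ∘ₗ
        comul.rTensor C ∘ₗ comul := by
    simp only [deformedConv, LinearMap.rTensor, ← LinearMap.comp_assoc]
    rw [LinearMap.comp_assoc (TensorProduct.map comul _), ← TensorProduct.map_comp,
      LinearMap.comp_id]
  have hr : deformedConv α f (deformedConv α g h) =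
      (aMul K H α ∘ₗ TensorProduct.map f (aMul K H α ∘ₗ TensorProduct.map g h)) ∘ₗ
        comul.lTensor C ∘ₗ comul := by
    simp only [deformedConv, LinearMap.lTensor, ← LinearMap.comp_assoc]
    rw [LinearMap.comp_assoc (TensorProduct.map _ comul), ← TensorProduct.map_comp,
      LinearMap.comp_id]
  rw [hl, hr, hfgh, LinearMap.comp_assoc, coassoc]

/-- The unit of `deformedConv`. -/
noncomputable def convUnit : C →ₗ[K] H := Algebra.linearMap K H ∘ₗ counit

lemma convUnit_apply (c : C) : (convUnit : C →ₗ[K] H) c = counit (R := K) c • (1 : H) := by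
  simp [convUnit, Algebra.algebraMap_eq_smul_one]

lemma convUnit_comp (u : D →ₗc[K] C) :
    (convUnit : C →ₗ[K] H) ∘ₗ u.toLinearMap = convUnit := by
  rw [convUnit, LinearMap.comp_assoc, u.counit_comp, convUnit]

lemma deformedConv_convUnit {α : H ⊗[K] H →ₗ[K] K} (hα : IsHopfCocycle K H α)
    (f : C →ₗ[K] H) : deformedConv α f convUnit = f := by
  ext c
  simp only [deformedConv_repr _ _ _ (ℛ K c), convUnit_apply, TensorProduct.tmul_smul, map_smul,
    aMul_one_right hα]
  have h := congr(TensorProduct.rid K C $(sum_tmul_counit_eq (R := K) (ℛ K c)))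
  simp only [map_sum, TensorProduct.rid_tmul, one_smul] at h
  simp only [← map_smul, ← map_sum, h]

lemma convUnit_deformedConv {α : H ⊗[K] H →ₗ[K] K} (hα : IsHopfCocycle K H α)
    (f : C →ₗ[K] H) : deformedConv α convUnit f = f := by
  ext c
  simp only [deformedConv_repr _ _ _ (ℛ K c), convUnit_apply, ← TensorProduct.smul_tmul',
    map_smul, aMul_one_left hα]
  simp only [← map_smul, ← map_sum, sum_counit_smul]

lemma deformedConv_comp (α : H ⊗[K] H →ₗ[K] K) (f g : C →ₗ[K] H) (u : D →ₗc[K] C) :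
    deformedConv α f g ∘ₗ u.toLinearMap =
      deformedConv α (f ∘ₗ u.toLinearMap) (g ∘ₗ u.toLinearMap) := by
  simp only [deformedConv, LinearMap.comp_assoc, ← u.map_comp_comul, TensorProduct.map_comp]

lemma convSMul_deformedConv (α : H ⊗[K] H →ₗ[K] K) (φ : C →ₗ[K] K) (f g : C →ₗ[K] H) :
    convSMul φ (deformedConv α f g) = deformedConv α (convSMul φ f) g := by
  have h : (TensorProduct.lid K H).toLinearMap ∘ₗ
      TensorProduct.map φ (aMul K H α ∘ₗ TensorProduct.map f g) ∘ₗ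
        (TensorProduct.assoc K C C C).toLinearMap =
      aMul K H α ∘ₗ TensorProduct.map
        ((TensorProduct.lid K H).toLinearMap ∘ₗ TensorProduct.map φ f) g := by
    refine TensorProduct.ext_threefold fun a b c => ?_
    simp [← TensorProduct.smul_tmul']
  ext c
  have h' := congr($h (comul.rTensor C (comul c)))
  simp only [LinearMap.comp_apply, LinearEquiv.coe_coe, coassoc_apply] at h'
  simpa [convSMul, deformedConv, LinearMap.lTensor, LinearMap.rTensor, TensorProduct.map_map,
    LinearMap.comp_assoc] using h'

lemma deformedConv_eq_convUnit_symm [FiniteDimensional K C] [FiniteDimensional K H]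
    {α : H ⊗[K] H →ₗ[K] K} (hα : IsHopfCocycle K H α) {f g : C →ₗ[K] H}
    (h : deformedConv α f g = convUnit) : deformedConv α g f = convUnit := by
  let L : (C →ₗ[K] H) →ₗ[K] (C →ₗ[K] H) :=
    { toFun := fun k => deformedConv α g k
      map_add' := fun k l => by
        simp [deformedConv, TensorProduct.map_add_right, LinearMap.add_comp, LinearMap.comp_add]
      map_smul' := fun r k => by
        simp [deformedConv, TensorProduct.map_smul_right, LinearMap.smul_comp,
          LinearMap.comp_smul] }
  have hinj : Function.Injective L := by
    refine Function.LeftInverse.injective (g := fun k => deformedConv α f k) fun k => ?_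
    change deformedConv α f (deformedConv α g k) = k
    rw [← deformedConv_assoc hα, h, convUnit_deformedConv hα]
  obtain ⟨k, hk⟩ := LinearMap.surjective_of_injective hinj convUnit
  change deformedConv α g k = convUnit at hk
  have : f = k := by
    rw [← deformedConv_convUnit hα f, ← hk, ← deformedConv_assoc hα, h,
      convUnit_deformedConv hα]
  rw [this, hk]

end Deformed

lemma deformedConv_linearMap_comp {C : Type u} [AddCommGroup C] [Module K C] [Coalgebra K C]
    {α : H ⊗[K] H →ₗ[K] K} (hα : IsHopfCocycle K H α) (f : C →ₗ[K] H) (φ : C →ₗ[K] K) :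
    deformedConv α f (Algebra.linearMap K H ∘ₗ φ) =
      convH K f (Algebra.linearMap K H ∘ₗ φ) := by
  have h : aMul K H α ∘ₗ TensorProduct.map f (Algebra.linearMap K H ∘ₗ φ) =
      LinearMap.mul' K H ∘ₗ TensorProduct.map f (Algebra.linearMap K H ∘ₗ φ) := by
    refine TensorProduct.ext' fun a b => ?_
    simp [Algebra.algebraMap_eq_smul_one, aMul_one_right hα]
  rw [deformedConv, convH, ← LinearMap.comp_assoc, h]
  rfl

lemma deformedConv_id_antipode (α : H ⊗[K] H →ₗ[K] K) :
    deformedConv α LinearMap.id (antipode K) =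
      Algebra.linearMap K H ∘ₗ cocycleGamma K H α := by
  have key := comp_map_comul_comul_eq_of_inner
    (Z := H) (LinearMap.mul' K H ∘ₗ (antipode K).lTensor H)
    (Algebra.linearMap K H ∘ₗ counit)
    (by rw [LinearMap.comp_assoc]; exact HopfAlgebra.mul_antipode_lTensor_comul)
    (((TensorProduct.lid K H).toLinearMap ∘ₗ TensorProduct.map α (LinearMap.mul' K H) ∘ₗ
      (TensorProduct.tensorTensorTensorComm K H H H H).toLinearMap) ∘ₗ
        (TensorProduct.map (antipode K) (antipode K) ∘ₗ
          (TensorProduct.comm K H H).toLinearMap).lTensor (H ⊗[K] H))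
    ((TensorProduct.lid K H).toLinearMap ∘ₗ
      (α ∘ₗ (antipode K).lTensor H).rTensor H ∘ₗ
        (TensorProduct.assoc K H H H).symm.toLinearMap ∘ₗ
          (TensorProduct.comm K H H).toLinearMap.lTensor H)
    (fun a b c d => by simp)
  have hΨ : ((TensorProduct.lid K H).toLinearMap ∘ₗ
      (α ∘ₗ (antipode K).lTensor H).rTensor H ∘ₗ
        (TensorProduct.assoc K H H H).symm.toLinearMap ∘ₗ
          (TensorProduct.comm K H H).toLinearMap.lTensor H) ∘ₗ
            (TensorProduct.mk K H H 1).lTensor H =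
      Algebra.linearMap K H ∘ₗ α ∘ₗ TensorProduct.map LinearMap.id (antipode K) := by
    ext a b
    simp [Algebra.algebraMap_eq_smul_one]
  have hmap : TensorProduct.map comul comul ∘ₗ
        TensorProduct.map LinearMap.id (antipode K (A := H)) =
      (TensorProduct.map (antipode K) (antipode K) ∘ₗ
          (TensorProduct.comm K H H).toLinearMap).lTensor (H ⊗[K] H) ∘ₗ
        TensorProduct.map comul comul := by
    rw [LinearMap.lTensor, ← TensorProduct.map_comp, ← TensorProduct.map_comp,
      comul_comp_antipode, LinearMap.id_comp, LinearMap.comp_id, LinearMap.comp_assoc]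
  have hcomul : comul (R := K) (A := H ⊗[K] H) =
      (TensorProduct.tensorTensorTensorComm K H H H H).toLinearMap ∘ₗ
        TensorProduct.map comul comul := by
    refine TensorProduct.ext' fun a b => ?_
    rw [TensorProduct.comul_tmul]
    rfl
  rw [rTensor_linearMap_counit_comul, ← LinearMap.comp_assoc _ (LinearMap.lTensor _ _), hΨ] at key
  rw [deformedConv, aMul_eq_convSMul, convSMul, hcomul, cocycleGamma]
  refine Eq.trans ?_ (key.trans ?_)
  · simp only [LinearMap.comp_assoc]
    rw [← LinearMap.comp_assoc _ _ (TensorProduct.map comul comul), hmap, LinearMap.comp_assoc]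
  · simp only [LinearMap.comp_assoc]

/-- The twisted antipode is a right convolution inverse of the identity `H → ^αH`. -/
lemma deformedConv_id_tAntipode {α : H ⊗[K] H →ₗ[K] K} (hα : IsHopfCocycle K H α)
    {γ' : H →ₗ[K] K} (hγ' : convH K (cocycleGamma K H α) γ' = counit) :
    deformedConv α LinearMap.id (tAntipode K H γ') = convUnit := by
  rw [tAntipode, ← deformedConv_linearMap_comp hα, ← deformedConv_assoc hα,
    deformedConv_id_antipode, deformedConv_linearMap_comp hα, convUnit, ← hγ']
  ext c
  simp only [convH, LinearMap.comp_apply]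
  induction comul (R := K) c using TensorProduct.induction_on with
  | zero => simp
  | tmul a b => simp
  | add s t hs ht => simp only [map_add, hs, ht]

variable (K H) in
/-- The coalgebra map `x ⊗ y ↦ ε(y) • x`. -/
noncomputable def fstCoalgHom : H ⊗[K] H →ₗc[K] H :=
  (Coalgebra.TensorProduct.rid K K H).toCoalgHom.comp
    (Coalgebra.TensorProduct.map (CoalgHom.id K H) (Coalgebra.counitCoalgHom K H))

variable (K H) in
/-- The coalgebra map `x ⊗ y ↦ ε(x) • y`. -/
noncomputable def sndCoalgHom : H ⊗[K] H →ₗc[K] H :=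
  (Coalgebra.TensorProduct.lid K H).toCoalgHom.comp
    (Coalgebra.TensorProduct.map (Coalgebra.counitCoalgHom K H) (CoalgHom.id K H))

lemma map_fst_snd_comul :
    TensorProduct.map (fstCoalgHom K H).toLinearMap (sndCoalgHom K H).toLinearMap ∘ₗ comul =
      LinearMap.id := by
  refine TensorProduct.ext' fun x y => ?_
  have hx := congr(TensorProduct.rid K H $(lTensor_counit_comul (R := K) x))
  have hy := congr(TensorProduct.lid K H $(rTensor_counit_comul (R := K) y))
  simp only [TensorProduct.rid_tmul, TensorProduct.lid_tmul, one_smul] at hx hy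
  rw [LinearMap.comp_apply, TensorProduct.comul_tmul, LinearMap.id_apply]
  conv_rhs => rw [← hx, ← hy]
  induction comul (R := K) x using TensorProduct.induction_on with
  | zero => simp
  | add s t hs ht => simp only [map_add, TensorProduct.add_tmul, hs, ht]
  | tmul a b =>
    induction comul (R := K) y using TensorProduct.induction_on with
    | zero => simp
    | add s t hs ht => simp only [map_add, TensorProduct.tmul_add, hs, ht]
    | tmul a' b' =>
      change (counit (R := K) a' • a) ⊗ₜ[K] (counit (R := K) b • b') =
        (counit (R := K) b • a) ⊗ₜ[K] (counit (R := K) a' • b')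
      simp only [← TensorProduct.smul_tmul', TensorProduct.tmul_smul, smul_smul, mul_comm]

lemma map_snd_fst_comul :
    TensorProduct.map (sndCoalgHom K H).toLinearMap (fstCoalgHom K H).toLinearMap ∘ₗ comul =
      (TensorProduct.comm K H H).toLinearMap := by
  refine TensorProduct.ext' fun x y => ?_
  have hx := congr(TensorProduct.lid K H $(rTensor_counit_comul (R := K) x))
  have hy := congr(TensorProduct.rid K H $(lTensor_counit_comul (R := K) y))
  simp only [TensorProduct.rid_tmul, TensorProduct.lid_tmul, one_smul] at hx hy
  rw [LinearMap.comp_apply, TensorProduct.comul_tmul, LinearEquiv.coe_coe,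
    TensorProduct.comm_tmul]
  conv_rhs => rw [← hx, ← hy]
  induction comul (R := K) x using TensorProduct.induction_on with
  | zero => simp
  | add s t hs ht => simp only [map_add, TensorProduct.tmul_add, TensorProduct.add_tmul, hs, ht]
  | tmul a b =>
    induction comul (R := K) y using TensorProduct.induction_on with
    | zero => simp
    | add s t hs ht => simp only [map_add, TensorProduct.tmul_add, TensorProduct.add_tmul, hs, ht]
    | tmul a' b' =>
      change (counit (R := K) a • a') ⊗ₜ[K] (counit (R := K) b' • b) =
        (counit (R := K) b' • a') ⊗ₜ[K] (counit (R := K) a • b)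
      simp only [← TensorProduct.smul_tmul', TensorProduct.tmul_smul, smul_smul, mul_comm]

section ConvolutionIntoH

variable {C : Type u} [AddCommGroup C] [Module K C] [Coalgebra K C]

lemma convSMul_convUnit (φ : C →ₗ[K] K) :
    convSMul φ (convUnit : C →ₗ[K] H) = Algebra.linearMap K H ∘ₗ φ := by
  ext c
  have h := congr(TensorProduct.rid K C $(sum_tmul_counit_eq (R := K) (ℛ K c)))
  simp only [map_sum, TensorProduct.rid_tmul, one_smul] at h
  rw [convSMul_repr _ _ (ℛ K c)]
  conv_rhs => rw [← h]
  simp [convUnit_apply, Algebra.algebraMap_eq_smul_one, smul_smul, mul_comm]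

/-- `f(x₁)φ(x₂) ⊗ g(x₃) = f(x₁) ⊗ φ(x₂)g(x₃)`. -/
lemma map_convH_linearMap_comul {M : Type u} [AddCommGroup M] [Module K M]
    (f : C →ₗ[K] H) (φ : C →ₗ[K] K) (g : C →ₗ[K] M) :
    TensorProduct.map (convH K f (Algebra.linearMap K H ∘ₗ φ)) g ∘ₗ comul =
      TensorProduct.map f (convSMul φ g) ∘ₗ comul := by
  have h : TensorProduct.map f ((TensorProduct.lid K M).toLinearMap ∘ₗ TensorProduct.map φ g) ∘ₗ
        (TensorProduct.assoc K C C C).toLinearMap =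
      TensorProduct.map (LinearMap.mul' K H ∘ₗ
        TensorProduct.map f (Algebra.linearMap K H ∘ₗ φ)) g := by
    refine TensorProduct.ext_threefold fun a b c => ?_
    simp [Algebra.algebraMap_eq_smul_one, ← TensorProduct.smul_tmul']
  ext c
  have h' := congr($h (comul.rTensor C (comul c)))
  simp only [LinearMap.comp_apply, LinearEquiv.coe_coe, coassoc_apply] at h'
  simpa [convSMul, convH, LinearMap.lTensor, LinearMap.rTensor, TensorProduct.map_map,
    LinearMap.comp_assoc] using h'.symm

end ConvolutionIntoH

/-- `S̃(xy) = (S̃(y₁) ·_α S̃(x₁)) α(x₂, y₂)`. -/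
lemma tAntipode_comp_mul' [FiniteDimensional K H] {α : H ⊗[K] H →ₗ[K] K}
    (hα : IsHopfCocycle K H α) {γ' : H →ₗ[K] K}
    (hγ' : convH K (cocycleGamma K H α) γ' = counit) :
    tAntipode K H γ' ∘ₗ LinearMap.mul' K H =
      convH K (aMul K H α ∘ₗ TensorProduct.map (tAntipode K H γ') (tAntipode K H γ') ∘ₗ
        (TensorProduct.comm K H H).toLinearMap) (Algebra.linearMap K H ∘ₗ α) := by
  set S := tAntipode K H γ'
  have hr : deformedConv α LinearMap.id S = convUnit := deformedConv_id_tAntipode hα hγ'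
  have hl : deformedConv α S LinearMap.id = convUnit := deformedConv_eq_convUnit_symm hα hr
  have hrC (u : H ⊗[K] H →ₗc[K] H) :
      deformedConv α u.toLinearMap (S ∘ₗ u.toLinearMap) = convUnit := by
    rw [← convUnit_comp u, ← hr, deformedConv_comp, LinearMap.id_comp]
  set W : H ⊗[K] H →ₗ[K] H := aMul K H α ∘ₗ TensorProduct.map S S ∘ₗ
    (TensorProduct.comm K H H).toLinearMap
  set p₁ := (fstCoalgHom K H).toLinearMap with hp₁
  set p₂ := (sndCoalgHom K H).toLinearMap with hp₂
  have hW : W = deformedConv α (S ∘ₗ p₂) (S ∘ₗ p₁) := by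
    simp only [W, deformedConv]
    rw [← map_snd_fst_comul, ← LinearMap.comp_assoc comul, ← TensorProduct.map_comp]
  have hm : deformedConv α p₁ p₂ = aMul K H α := by
    rw [deformedConv, map_fst_snd_comul, LinearMap.comp_id]
  have hmW : deformedConv α (aMul K H α) W = convUnit := by
    rw [hW, ← hm, deformedConv_assoc hα, ← deformedConv_assoc hα p₂, hrC,
      convUnit_deformedConv hα, hrC]
  obtain ⟨β, hαβ, hβα⟩ := hα.conv_invertible
  have hmulW : deformedConv α (LinearMap.mul' K H) W = convSMul β convUnit := by
    rw [← hmW, aMul_eq_convSMul, ← convSMul_deformedConv, convSMul_convSMul, hβα, convSMul_counit]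
  have hSm : deformedConv α (S ∘ₗ LinearMap.mul' K H) (LinearMap.mul' K H) = convUnit := by
    rw [← convUnit_comp (Bialgebra.mulCoalgHom K H), ← hl, deformedConv_comp, LinearMap.id_comp]
    rfl
  have hWS : W = deformedConv α (S ∘ₗ LinearMap.mul' K H) (convSMul β convUnit) := by
    rw [← hmulW, ← deformedConv_assoc hα, hSm, convUnit_deformedConv hα]
  rw [← deformedConv_linearMap_comp hα, ← convSMul_convUnit, hWS, deformedConv_assoc hα,
    ← convSMul_deformedConv, convUnit_deformedConv hα, convSMul_convSMul, hβα, convSMul_counit,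
    deformedConv_convUnit hα]

lemma tAntipode_one {α : H ⊗[K] H →ₗ[K] K} (hα : IsHopfCocycle K H α) {γ' : H →ₗ[K] K}
    (hγ' : convH K (cocycleGamma K H α) γ' = counit) : tAntipode K H γ' 1 = 1 := by
  have hγ : cocycleGamma K H α 1 = 1 := by
    simp [cocycleGamma, Algebra.TensorProduct.one_def, hα.unit_left]
  have h := congr($hγ' 1)
  simp only [convH, LinearMap.comp_apply, Bialgebra.comul_one, Algebra.TensorProduct.one_def,
    TensorProduct.map_tmul, LinearMap.mul'_apply, hγ, one_mul, Bialgebra.counit_one] at h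
  simp [tAntipode, convH, Algebra.TensorProduct.one_def, h]

lemma map_tAntipode_comul_comp_mul' [FiniteDimensional K H] {α : H ⊗[K] H →ₗ[K] K}
    (hα : IsHopfCocycle K H α) {γ' : H →ₗ[K] K}
    (hγ' : convH K (cocycleGamma K H α) γ' = counit) :
    (TensorProduct.map (tAntipode K H γ') LinearMap.id ∘ₗ comul) ∘ₗ LinearMap.mul' K H =
      opMulA K H α ∘ₗ TensorProduct.map
        (TensorProduct.map (tAntipode K H γ') LinearMap.id ∘ₗ comul)
        (TensorProduct.map (tAntipode K H γ') LinearMap.id ∘ₗ comul) := by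
  have hmul : comul ∘ₗ LinearMap.mul' K H =
      TensorProduct.map (LinearMap.mul' K H) (LinearMap.mul' K H) ∘ₗ comul :=
    (Bialgebra.mulCoalgHom K H).map_comp_comul.symm
  rw [LinearMap.comp_assoc, hmul, ← LinearMap.comp_assoc, ← TensorProduct.map_comp,
    LinearMap.id_comp, tAntipode_comp_mul' hα hγ', map_convH_linearMap_comul, ← aMul_eq_convSMul]
  refine TensorProduct.ext' fun x y => ?_
  simp only [LinearMap.comp_apply, TensorProduct.map_tmul, TensorProduct.comul_tmul]
  induction comul (R := K) x using TensorProduct.induction_on with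
  | zero => simp
  | add s t hs ht => simp only [map_add, TensorProduct.add_tmul, hs, ht]
  | tmul a b =>
    induction comul (R := K) y using TensorProduct.induction_on with
    | zero => simp
    | add s t hs ht => simp only [map_add, TensorProduct.tmul_add, hs, ht]
    | tmul a' b' => simp [opMulA]

end HopfCocycle

end Helpers

/-- `T̃(h) = S̃(h₁) ⊗ h₂` is an algebra homomorphism
`H → (^αH)^op ⊗ ^αH`. -/
theorem tildeT_is_opposite_algebra_hom
    (K H : Type u) [Field K] [CharZero K] [Ring H] [HopfAlgebra K H]
    [FiniteDimensional K H]
    (α : H ⊗[K] H →ₗ[K] K) (hα : IsHopfCocycle K H α)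
    (γ' : H →ₗ[K] K)
    (hγ' : convH K (cocycleGamma K H α) γ' = Coalgebra.counit ∧
           convH K γ' (cocycleGamma K H α) = Coalgebra.counit) :
    (TensorProduct.map (tAntipode K H γ') LinearMap.id ∘ₗ (Coalgebra.comul (A := H)))
        (1 : H) = (1 : H) ⊗ₜ[K] (1 : H) ∧
    ∀ x y : H,
      (TensorProduct.map (tAntipode K H γ') LinearMap.id ∘ₗ (Coalgebra.comul (A := H)))
          (x * y) =
        opMulA K H α
          (((TensorProduct.map (tAntipode K H γ') LinearMap.id ∘ₗ
              (Coalgebra.comul (A := H))) x) ⊗ₜ[K]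
           ((TensorProduct.map (tAntipode K H γ') LinearMap.id ∘ₗ
              (Coalgebra.comul (A := H))) y)) := by
  refine ⟨?_, fun x y => ?_⟩
  · simp [Algebra.TensorProduct.one_def, tAntipode_one hα hγ'.1]
  · exact congr($(map_tAntipode_comul_comp_mul' hα hγ'.1) (x ⊗ₜ y))
end

section
/- Let K be an algebraically closed field of characteristic zero, W a finite-dimensional K-vector space, and p a natural number. For σ ∈ S_p let L_σ : W^{⊗p} → W^{⊗p} be the permutation operator L_σ(w_1 ⊗ ⋯ ⊗ w_p) = w_{σ^{-1}(1)} ⊗ ⋯ ⊗ w_{σ^{-1}(p)}. Then every linear functional φ : End_K(W^{⊗p}) → K which is GL(W)-invariant, i.e. satisfies φ(g^{⊗p} ∘ T ∘ (g^{-1})^{⊗p}) = φ(T) for all g ∈ GL(W) and all T, lies in the linear span of the functionals T ↦ Tr_{W^{⊗p}}(L_σ ∘ T) for σ ∈ S_p. -/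
open scoped TensorProduct

universe u

/-- The permutation operator `L_σ : w₁ ⊗ ⋯ ⊗ w_p ↦ w_{σ⁻¹(1)} ⊗ ⋯ ⊗ w_{σ⁻¹(p)}` on the
`p`-th tensor power. -/
noncomputable def permOp (K : Type u) [Field K] (W : Type u) [AddCommGroup W] [Module K W]
    (p : ℕ) (σ : Equiv.Perm (Fin p)) :
    (⨂[K] (_ : Fin p), W) →ₗ[K] (⨂[K] (_ : Fin p), W) :=
  (PiTensorProduct.reindex K (fun _ : Fin p => W) σ).toLinearMap

/-- Polarization: the symmetrization of a multilinear map which vanishes on the diagonal is zero. -/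
theorem MultilinearMap.sum_perm_eq_zero_of_diagonal {R ι M N : Type*} [CommRing R] [Fintype ι]
    [DecidableEq ι] [AddCommGroup M] [Module R M] [AddCommGroup N] [Module R N]
    (F : MultilinearMap R (fun _ : ι => M) N) (hF : ∀ m, F (fun _ => m) = 0) (f : ι → M) :
    ∑ σ : Equiv.Perm ι, F (fun i => f (σ i)) = 0 := by
  classical
  have hsign (r : ι → ι) : (∑ s : Finset ι, if ∀ i, r i ∈ s then (-1 : R) ^ (sᶜ).card else 0) =
      if Function.Bijective r then 1 else 0 := by
    have h := Fintype.prod_add (fun _ : ι => (1 : R)) (fun j => if j ∈ Set.range r then 0 else -1)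
    have hl : (∏ j, ((1 : R) + if j ∈ Set.range r then 0 else -1)) =
        if Function.Bijective r then 1 else 0 := by
      split_ifs with hr
      · exact Finset.prod_eq_one fun j _ => by simp [Set.mem_range.2 (hr.surjective j)]
      · rw [← Finite.surjective_iff_bijective] at hr
        obtain ⟨j, hj⟩ := not_forall.1 hr
        exact Finset.prod_eq_zero (Finset.mem_univ j) (by simp [Set.mem_range, hj])
    rw [← hl, h]
    refine Finset.sum_congr rfl fun s _ => ?_
    rw [Finset.prod_const_one, one_mul]
    split_ifs with hs
    · rw [← Finset.prod_const]
      refine Finset.prod_congr rfl fun j hj => ?_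
      rw [if_neg]
      rintro ⟨i, rfl⟩
      exact Finset.mem_compl.1 hj (hs i)
    · obtain ⟨i, hi⟩ := not_forall.1 hs
      exact (Finset.prod_eq_zero (Finset.mem_compl.2 hi) (by simp)).symm
  calc ∑ σ : Equiv.Perm ι, F (fun i => f (σ i))
      = ∑ r : ι → ι, (if Function.Bijective r then (1 : R) else 0) • F (fun i => f (r i)) := by
        simp_rw [ite_smul, one_smul, zero_smul]
        rw [← Finset.sum_filter]
        refine Finset.sum_bij (fun σ _ => σ) (fun σ _ => by simp)
          (fun σ _ τ _ h => Equiv.coe_fn_injective h) (fun r hr => ?_) (fun _ _ => rfl)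
        exact ⟨Equiv.ofBijective r (Finset.mem_filter.1 hr).2, Finset.mem_univ _, rfl⟩
    _ = ∑ s : Finset ι, (-1 : R) ^ (sᶜ).card • F (fun _ => ∑ j ∈ s, f j) := by
        simp_rw [← hsign, Finset.sum_smul, F.map_sum_finset, ite_smul, zero_smul]
        rw [Finset.sum_comm]
        refine Finset.sum_congr rfl fun s _ => ?_
        rw [← Finset.sum_filter, Finset.smul_sum]
        exact Finset.sum_congr (by ext r; simp) fun _ _ => rfl
    _ = 0 := by simp [hF]

/-- Zariski density of the units: a multilinear map on endomorphisms which vanishes at the constant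
families of units vanishes at all constant families. -/
theorem MultilinearMap.apply_diagonal_eq_zero_of_isUnit {K ι W N : Type*} [Field K] [Infinite K]
    [Fintype ι] [AddCommGroup W] [Module K W] [FiniteDimensional K W] [AddCommGroup N] [Module K N]
    (F : MultilinearMap K (fun _ : ι => Module.End K W) N)
    (hF : ∀ g : Module.End K W, IsUnit g → F (fun _ => g) = 0) (f : Module.End K W) :
    F (fun _ => f) = 0 := by
  classical
  rw [← Module.forall_dual_apply_eq_zero_iff K]
  intro l
  let P : Polynomial K := ∑ s : Finset ι,
    Polynomial.C (l (F (s.piecewise (fun _ => 1) (fun _ => f)))) * Polynomial.X ^ s.card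
  have hP (t : K) : P.eval t = l (F (fun _ => t • 1 + f)) := by
    have h := F.map_add_univ (fun _ => t • 1) (fun _ => f)
    rw [show (fun _ : ι => t • (1 : Module.End K W) + f) = (fun _ => t • 1) + fun _ => f from rfl,
      h, _root_.map_sum, Polynomial.eval_finsetSum]
    refine Finset.sum_congr rfl fun s _ => ?_
    have h' := F.map_piecewise_smul (fun _ => t) (s.piecewise (fun _ => 1) (fun _ => f)) s
    rw [Finset.prod_const] at h'
    rw [show s.piecewise (fun _ => t • (1 : Module.End K W)) (fun _ => f) =
      s.piecewise (fun i => t • s.piecewise (fun _ => (1 : Module.End K W)) (fun _ => f) i)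
        (s.piecewise (fun _ => 1) (fun _ => f)) by
        ext1 i; by_cases hi : i ∈ s <;> simp [hi], h']
    rw [map_smul, smul_eq_mul, Polynomial.eval_mul, Polynomial.eval_C, Polynomial.eval_pow,
      Polynomial.eval_X, mul_comm]
  have hfin : (spectrum K (-f)).Finite := by
    convert! (-f).finite_hasEigenvalue using 1
    ext t
    exact Module.End.hasEigenvalue_iff_mem_spectrum.symm
  have hzero : P = 0 := by
    refine P.eq_zero_of_infinite_isRoot (hfin.infinite_compl.mono fun t ht => ?_)
    have hu : IsUnit (t • 1 + f) := by
      have h := spectrum.notMem_iff.1 ht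
      rwa [sub_neg_eq_add, Algebra.algebraMap_eq_smul_one] at h
    simp [Polynomial.IsRoot, hP, hF _ hu]
  simpa [hzero] using (hP 0).symm

theorem LinearMap.trace_comp_smulRight {K V : Type*} [Field K] [AddCommGroup V] [Module K V]
    [FiniteDimensional K V] (A : V →ₗ[K] V) (l : V →ₗ[K] K) (v : V) :
    LinearMap.trace K V (A ∘ₗ l.smulRight v) = l (A v) := by
  have h : A ∘ₗ l.smulRight v = l.smulRight (A v) := LinearMap.ext fun x => map_smul A (l x) v
  rw [h, LinearMap.trace_smulRight]

/-- The trace pairing on endomorphisms. -/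
noncomputable def Module.End.tracePairing (K V : Type*) [Field K] [AddCommGroup V] [Module K V] :
    Module.End K V →ₗ[K] Module.Dual K (Module.End K V) :=
  (LinearMap.mul K (Module.End K V)).compr₂ (LinearMap.trace K V)

theorem Module.End.tracePairing_apply {K V : Type*} [Field K] [AddCommGroup V] [Module K V]
    (A T : Module.End K V) : Module.End.tracePairing K V A T = LinearMap.trace K V (A * T) := rfl

theorem Module.End.tracePairing_injective (K V : Type*) [Field K] [AddCommGroup V] [Module K V]
    [FiniteDimensional K V] : Function.Injective (Module.End.tracePairing K V) := by
  rw [injective_iff_map_eq_zero]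
  intro A hA
  ext v
  rw [LinearMap.zero_apply, ← Module.forall_dual_apply_eq_zero_iff K]
  intro l
  have h : Module.End.tracePairing K V A (l.smulRight v) = 0 := by rw [hA]; rfl
  rwa [Module.End.tracePairing_apply, Module.End.mul_eq_comp, LinearMap.trace_comp_smulRight] at h

theorem Module.End.tracePairing_surjective (K V : Type*) [Field K] [AddCommGroup V] [Module K V]
    [FiniteDimensional K V] : Function.Surjective (Module.End.tracePairing K V) :=
  (LinearMap.injective_iff_surjective_of_finrank_eq_finrank
    Subspace.dual_finrank_eq.symm).1 (Module.End.tracePairing_injective K V)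

open Module in
/-- The endomorphisms of a tensor power are spanned by the tensor products of endomorphisms. -/
theorem PiTensorProduct.span_range_map_eq_top (K ι W : Type*) [Field K] [Fintype ι]
    [AddCommGroup W] [Module K W] [FiniteDimensional K W] :
    Submodule.span K (Set.range fun f : ι → (W →ₗ[K] W) => PiTensorProduct.map (R := K) f) = ⊤ := by
  by_contra hne
  obtain ⟨l, hl, hle⟩ := Submodule.exists_le_ker_of_lt_top _ (lt_top_iff_ne_top.2 hne)
  obtain ⟨A, rfl⟩ := End.tracePairing_surjective K (⨂[K] _ : ι, W) l
  refine hl ?_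
  suffices hA : A = 0 by rw [hA, map_zero]
  let b := finBasis K W
  let B := Basis.piTensorProduct (R := K) (fun _ : ι => b)
  ext w
  refine B.repr.injective (Finsupp.ext fun κ => ?_)
  have hmap : PiTensorProduct.map (R := K) (fun i => (b.coord (κ i)).smulRight (w i)) =
      (B.coord κ).smulRight (PiTensorProduct.tprod K w) := by
    ext x
    simp [B, MultilinearMap.map_smul_univ]
  have h : End.tracePairing K _ A
      (PiTensorProduct.map (R := K) fun i => (b.coord (κ i)).smulRight (w i)) = 0 :=
    hle (Submodule.subset_span ⟨_, rfl⟩)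
  rw [hmap, End.tracePairing_apply, End.mul_eq_comp,
    LinearMap.trace_comp_smulRight] at h
  simpa using h

open Module in
/-- The double centralizer theorem for a representation of a finite group. -/
theorem Representation.mem_span_range_of_commute_commutant {K G V : Type*} [Field K] [Group G]
    [Finite G] [NeZero (Nat.card G : K)] [AddCommGroup V] [Module K V] [FiniteDimensional K V]
    (ρ : Representation K G V) (A : End K V)
    (hA : ∀ B : End K V, (∀ g, Commute B (ρ g)) → Commute A B) :
    A ∈ Submodule.span K (Set.range ρ) := by
  let A' : End (End (MonoidAlgebra K G) ρ.asModule) ρ.asModule :=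
    { toFun := fun v => ρ.asModuleEquiv.symm (A (ρ.asModuleEquiv v))
      map_add' := by simp
      map_smul' := fun B v => by
        let B' : End K V := ρ.asModuleEquiv.toLinearMap ∘ₗ (B.restrictScalars K) ∘ₗ
          ρ.asModuleEquiv.symm.toLinearMap
        have hB (g : G) : Commute B' (ρ g) := by
          ext v
          have h := congrArg ρ.asModuleEquiv
            (map_smul B (MonoidAlgebra.of K G g) (ρ.asModuleEquiv.symm v))
          rw [← asModuleEquiv_symm_map_rho, asModuleEquiv_map_smul, asAlgebraHom_of] at h
          exact h
        exact congrArg ρ.asModuleEquiv.symm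
          (LinearMap.congr_fun (hA B' hB).eq (ρ.asModuleEquiv v)) }
  classical
  obtain ⟨r, hr⟩ := jacobson_density A'
    (Finset.univ.image fun i => ρ.asModuleEquiv.symm (finBasis K V i))
  have hAr : A = ρ.asAlgebraHom r := by
    refine (finBasis K V).ext fun i => ?_
    have h := congrArg ρ.asModuleEquiv (hr _ (Finset.mem_image_of_mem _ (Finset.mem_univ i)))
    rw [asModuleEquiv_map_smul] at h
    exact h
  rw [hAr]
  clear hr hAr
  induction r using MonoidAlgebra.induction_linear with
  | zero => simp
  | add x y hx hy => rw [map_add]; exact Submodule.add_mem _ hx hy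
  | single g c =>
    rw [asAlgebraHom_single]
    exact Submodule.smul_mem _ _ (Submodule.subset_span ⟨g, rfl⟩)

/-- Every `GL(W)`-invariant linear functional on `End(W^{⊗p})` lies in the
span of the functionals `T ↦ Tr(L_σ ∘ T)`, `σ ∈ S_p` (Schur–Weyl duality). -/
theorem invariant_functionals_spanned_by_permutation_traces
    (K : Type u) [Field K] [IsAlgClosed K] [CharZero K]
    (W : Type u) [AddCommGroup W] [Module K W] [FiniteDimensional K W]
    (p : ℕ)
    (φ : ((⨂[K] (_ : Fin p), W) →ₗ[K] (⨂[K] (_ : Fin p), W)) →ₗ[K] K)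
    (hinv : ∀ (g : W ≃ₗ[K] W) (T : (⨂[K] (_ : Fin p), W) →ₗ[K] (⨂[K] (_ : Fin p), W)),
      φ (PiTensorProduct.map (fun _ : Fin p => g.toLinearMap) ∘ₗ T ∘ₗ
          PiTensorProduct.map (fun _ : Fin p => g.symm.toLinearMap)) = φ T) :
    φ ∈ Submodule.span K
      (Set.range fun σ : Equiv.Perm (Fin p) =>
        LinearMap.trace K (⨂[K] (_ : Fin p), W) ∘ₗ
          LinearMap.llcomp K (⨂[K] (_ : Fin p), W) (⨂[K] (_ : Fin p), W)
            (⨂[K] (_ : Fin p), W) (permOp K W p σ)) := by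
  let V := ⨂[K] (_ : Fin p), W
  obtain ⟨A, rfl⟩ := Module.End.tracePairing_surjective K V φ
  let ρ : Representation K (Equiv.Perm (Fin p)) V :=
    { toFun := permOp K W p
      map_one' := by
        ext; simp only [permOp, LinearMap.compMultilinearMap_apply, LinearEquiv.coe_coe,
          PiTensorProduct.reindex_tprod]; rfl
      map_mul' := fun σ τ => by
        ext; simp only [permOp, LinearMap.compMultilinearMap_apply, LinearEquiv.coe_coe,
          Module.End.mul_apply, PiTensorProduct.reindex_tprod]; rfl }
  have hunit (g : Module.End K W) (hg : IsUnit g) :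
      Commute A (PiTensorProduct.map fun _ => g) := by
    obtain ⟨u, rfl⟩ := hg
    let e := LinearMap.GeneralLinearGroup.generalLinearEquiv K W u
    refine (Module.End.tracePairing_injective K V (LinearMap.ext fun T => ?_) : _ * _ = _ * _)
    have h := hinv e (T * PiTensorProduct.map fun _ => e.toLinearMap)
    rw [Module.End.tracePairing_apply, Module.End.tracePairing_apply] at h
    have he : (PiTensorProduct.map fun _ => e.toLinearMap) ∘ₗ
        (PiTensorProduct.map fun _ => e.symm.toLinearMap) = (LinearMap.id : Module.End K V) := by
      rw [← PiTensorProduct.map_comp]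
      simp [PiTensorProduct.map_id]
    rw [Module.End.mul_eq_comp T, LinearMap.comp_assoc, he, LinearMap.comp_id] at h
    rw [Module.End.tracePairing_apply, Module.End.tracePairing_apply, mul_assoc, mul_assoc]
    exact h.trans ((congrArg _ (mul_assoc _ _ _).symm).trans
      (LinearMap.trace_mul_comm K _ _))
  let F : MultilinearMap K (fun _ : Fin p => Module.End K W) (Module.End K V) :=
    (LinearMap.mulLeft K A - LinearMap.mulRight K A).compMultilinearMap
      (PiTensorProduct.mapMultilinear K _ _)
  have hF (g) : F (fun _ => g) = 0 := F.apply_diagonal_eq_zero_of_isUnit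
    (fun g hg => sub_eq_zero.2 (hunit g hg).eq) g
  have hconj (T : Module.End K V) : Commute A (∑ σ, ρ σ * T * ρ σ⁻¹) := by
    have hT : T ∈ Submodule.span K _ :=
      (PiTensorProduct.span_range_map_eq_top K (Fin p) W).ge Submodule.mem_top
    induction hT using Submodule.span_induction with
    | mem T hT =>
      obtain ⟨f, rfl⟩ := hT
      have hρ (σ) : ρ σ * PiTensorProduct.map f * ρ σ⁻¹ =
          PiTensorProduct.map fun i => f (σ⁻¹ i) := by
        have h : (PiTensorProduct.map fun i => f (σ⁻¹ i)) * ρ σ = ρ σ * PiTensorProduct.map f :=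
          PiTensorProduct.map_comp_reindex_eq f σ
        rw [← h, mul_assoc, ← map_mul, mul_inv_cancel, map_one, mul_one]
      have h := F.sum_perm_eq_zero_of_diagonal hF f
      rw [← Equiv.sum_comp (Equiv.inv _)] at h
      refine sub_eq_zero.1 ?_
      simp_rw [hρ, Finset.mul_sum, Finset.sum_mul, ← Finset.sum_sub_distrib]
      exact h
    | zero => simp
    | add S T _ _ hS hT =>
      simpa only [mul_add, add_mul, Finset.sum_add_distrib] using hS.add_right hT
    | smul c T _ hT =>
      simpa only [mul_smul_comm, smul_mul_assoc, ← Finset.smul_sum] using hT.smul_right c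
  have hA : A ∈ Submodule.span K (Set.range ρ) := by
    refine ρ.mem_span_range_of_commute_commutant A fun B hB => ?_
    have h := hconj B
    have h' (σ) : ρ σ * B * ρ σ⁻¹ = B := by
      rw [← (hB σ).eq, mul_assoc, ← map_mul, mul_inv_cancel, map_one, mul_one]
    simp only [h', Finset.sum_const, ← Nat.cast_smul_eq_nsmul K] at h
    exact (Commute.smul_right_iff₀ (Nat.cast_ne_zero.2 Finset.univ_nonempty.card_pos.ne')).1 h
  have h := Submodule.mem_map_of_mem (f := Module.End.tracePairing K V) hA
  rw [Submodule.map_span, ← Set.range_comp] at h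
  exact h
end

section
/- Let G be a finite group. Let A be the abelian group presented by generators a(g,h) for (g,h) ∈ G × G and relations a(g,h) + a(gh,k) = a(h,k) + a(g,hk) for all g, h, k ∈ G. Let ψ : A → ℤ^G be the group homomorphism determined by ψ(a(g,h)) = e_g + e_h − e_{gh}, where (e_g)_{g∈G} is the standard basis of the free abelian group ℤ^G. Let F be the free group on the set {x_g : g ∈ G}, let π : F → G be the homomorphism with π(x_g) = g, and let R = ker π. Then ker ψ is isomorphic as an abelian group to ([F,F] ∩ R)/[F,R]. -/
universe u

/-- A (not necessarily normalised) 2-cocycle on `G` with values in the trivial `G`-module `A`. -/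
structure TrivialCocycle (G A : Type*) [Group G] [AddCommGroup A] where
  /-- The underlying function. -/
  val : G → G → A
  cocycle : ∀ g h k, val g h + val (g * h) k = val h k + val g (h * k)

/-- The underlying set `A × G` of the central extension attached to a cocycle. -/
@[ext]
structure CocycleExtension {G A : Type*} [Group G] [AddCommGroup A]
    (c : TrivialCocycle G A) where
  /-- The component in the kernel. -/
  fst : A
  /-- The component in the quotient. -/
  snd : G

namespace CocycleExtension

variable {G A : Type*} [Group G] [AddCommGroup A] {c : TrivialCocycle G A}

lemma val_one_left (c : TrivialCocycle G A) (g : G) : c.val 1 g = c.val 1 1 := by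
  have h := c.cocycle 1 1 g
  simp only [one_mul] at h
  exact (add_right_cancel h).symm

instance : Mul (CocycleExtension c) :=
  ⟨fun x y => ⟨x.fst + y.fst + c.val x.snd y.snd, x.snd * y.snd⟩⟩

instance : One (CocycleExtension c) := ⟨⟨-c.val 1 1, 1⟩⟩

instance : Inv (CocycleExtension c) :=
  ⟨fun x => ⟨-x.fst - c.val x.snd⁻¹ x.snd - c.val 1 1, x.snd⁻¹⟩⟩

@[simp] lemma mul_fst (x y : CocycleExtension c) :
    (x * y).fst = x.fst + y.fst + c.val x.snd y.snd := rfl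
@[simp] lemma mul_snd (x y : CocycleExtension c) : (x * y).snd = x.snd * y.snd := rfl
@[simp] lemma one_fst : (1 : CocycleExtension c).fst = -c.val 1 1 := rfl
@[simp] lemma one_snd : (1 : CocycleExtension c).snd = 1 := rfl
@[simp] lemma inv_fst (x : CocycleExtension c) :
    x⁻¹.fst = -x.fst - c.val x.snd⁻¹ x.snd - c.val 1 1 := rfl
@[simp] lemma inv_snd (x : CocycleExtension c) : x⁻¹.snd = x.snd⁻¹ := rfl

instance : Group (CocycleExtension c) :=
  Group.ofLeftAxioms
    (fun x y z => by
      ext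
      · have h := c.cocycle x.snd y.snd z.snd
        simp only [mul_fst, mul_snd]
        rw [← sub_eq_zero] at h ⊢
        rw [← h]
        abel
      · simp [mul_assoc])
    (fun x => by
      ext
      · simp [val_one_left c x.snd]
      · simp)
    (fun x => by
      ext
      · simp only [mul_fst, inv_fst, inv_snd, one_fst]
        abel
      · simp)

/-- The projection of the extension onto the quotient. -/
def proj (c : TrivialCocycle G A) : CocycleExtension c →* G where
  toFun := snd
  map_one' := rfl
  map_mul' _ _ := rfl

/-- The inclusion of the kernel into the extension. -/
def incl (c : TrivialCocycle G A) : Multiplicative A →* CocycleExtension c where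
  toFun a := ⟨a.toAdd - c.val 1 1, 1⟩
  map_one' := by ext <;> simp
  map_mul' a b := by
    ext
    · simp only [toAdd_mul, mul_fst]
      abel
    · simp

/-- A map `A → C` into the centre and a set-theoretic map `s` on `G` whose defect is the image of
the cocycle define a homomorphism out of the extension. -/
def lift {E : Type*} [Group E] (φ : Multiplicative A →* E) (hφ : ∀ a x, φ a * x = x * φ a)
    (s : G → E) (hs : ∀ g h, s g * s h = φ (.ofAdd (c.val g h)) * s (g * h)) :
    CocycleExtension c →* E :=
  MonoidHom.mk' (fun x => φ (.ofAdd x.fst) * s x.snd) fun x y => by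
    simp only [mul_fst, mul_snd, ofAdd_add, map_mul]
    rw [mul_assoc (φ _) (s x.snd), ← mul_assoc (s x.snd), ← hφ _ (s x.snd), mul_assoc (φ _) (s _),
      hs, mul_assoc, mul_assoc]

lemma lift_apply {E : Type*} [Group E] (φ : Multiplicative A →* E)
    (hφ : ∀ a x, φ a * x = x * φ a) (s : G → E)
    (hs : ∀ g h, s g * s h = φ (.ofAdd (c.val g h)) * s (g * h)) (x : CocycleExtension c) :
    lift φ hφ s hs x = φ (.ofAdd x.fst) * s x.snd := rfl

/-- The homomorphism from the free group on `G` sending each generator to its standard lift. -/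
def ofFree (c : TrivialCocycle G A) : FreeGroup G →* CocycleExtension c :=
  FreeGroup.lift fun g => ⟨0, g⟩

@[simp] lemma ofFree_of (c : TrivialCocycle G A) (g : G) :
    ofFree c (FreeGroup.of g) = ⟨0, g⟩ := FreeGroup.lift_apply_of

lemma ofFree_snd (c : TrivialCocycle G A) (w : FreeGroup G) :
    (ofFree c w).snd = FreeGroup.lift (id : G → G) w := by
  have : (proj c).comp (ofFree c) = FreeGroup.lift (id : G → G) := by
    ext g
    simp [proj]
  exact DFunLike.congr_fun this w

lemma ofFree_relator (c : TrivialCocycle G A) (g h : G) :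
    ofFree c (FreeGroup.of g * FreeGroup.of h * (FreeGroup.of (g * h))⁻¹) =
      incl c (.ofAdd (c.val g h)) := by
  rw [map_mul, map_inv, mul_inv_eq_iff_eq_mul]
  ext <;> simp [incl, val_one_left c (g * h)]

lemma eq_incl_of_snd_eq_one {x : CocycleExtension c} (hx : x.snd = 1) :
    x = incl c (.ofAdd (x.fst + c.val 1 1)) := by
  ext <;> simp [incl, hx]

/-- The map from the relation subgroup to `A`. -/
def ofRelations (c : TrivialCocycle G A) :
    (FreeGroup.lift (id : G → G)).ker →* Multiplicative A :=
  MonoidHom.mk' (fun r => .ofAdd ((ofFree c r).fst + c.val 1 1)) fun r s => by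
    have hr := (ofFree_snd c r).trans r.2
    have hs := (ofFree_snd c s).trans s.2
    rw [← ofAdd_add]
    congr 1
    simp only [Subgroup.coe_mul, map_mul, mul_fst, hr, hs]
    abel

lemma incl_ofRelations (c : TrivialCocycle G A) (r : (FreeGroup.lift (id : G → G)).ker) :
    incl c (ofRelations c r) = ofFree c r :=
  (eq_incl_of_snd_eq_one ((ofFree_snd c r).trans r.2)).symm

lemma incl_injective (c : TrivialCocycle G A) : Function.Injective (incl c) := fun a b h => by
  simpa [incl] using h

lemma incl_central (c : TrivialCocycle G A) (a : Multiplicative A) (x : CocycleExtension c) :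
    incl c a * x = x * incl c a := by
  have h := c.cocycle x.snd 1 1
  simp only [mul_one] at h
  ext
  · simp only [incl, MonoidHom.coe_mk, OneHom.coe_mk, mul_fst, val_one_left c x.snd,
      add_right_cancel h]
    abel
  · simp [incl]

end CocycleExtension

open CocycleExtension

/-- The kernel of the map from a free group to the free abelian group is its commutator. -/
lemma mem_commutator_freeGroup_iff {X : Type*} (w : FreeGroup X) :
    w ∈ commutator (FreeGroup X) ↔
      FreeGroup.lift (fun x => Multiplicative.ofAdd (Finsupp.single x (1 : ℤ))) w = 1 := by
  constructor
  · exact fun h => Abelianization.commutator_subset_ker _ h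
  · intro h
    let j : (X →₀ ℤ) →+ Additive (Abelianization (FreeGroup X)) :=
      Finsupp.liftAddHom fun x =>
        zmultiplesHom _ (Additive.ofMul (Abelianization.of (FreeGroup.of x)))
    have hj : j.toMultiplicativeLeft.comp
        (FreeGroup.lift fun x => Multiplicative.ofAdd (Finsupp.single x (1 : ℤ))) =
          Abelianization.of := by
      ext x
      simp [j]
    rw [← Abelianization.ker_of, MonoidHom.mem_ker, ← hj, MonoidHom.comp_apply, h, map_one]

/-- The relation subgroup generated by the cocycle identities. -/
abbrev cocycleRelations (G : Type*) [Group G] : AddSubgroup (FreeAbelianGroup (G × G)) :=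
  AddSubgroup.closure {x : FreeAbelianGroup (G × G) | ∃ g h k : G,
    x = FreeAbelianGroup.of (g, h) + FreeAbelianGroup.of (g * h, k)
      - FreeAbelianGroup.of (h, k) - FreeAbelianGroup.of (g, h * k)}

/-- The target of the universal 2-cocycle on `G` with trivial coefficients. -/
abbrev CocycleModule (G : Type*) [Group G] := FreeAbelianGroup (G × G) ⧸ cocycleRelations G

/-- The universal 2-cocycle on `G` with trivial coefficients. -/
def universalCocycle (G : Type*) [Group G] : TrivialCocycle G (CocycleModule G) where
  val g h := QuotientAddGroup.mk (FreeAbelianGroup.of (g, h))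
  cocycle g h k := by
    rw [← sub_eq_zero, ← QuotientAddGroup.mk_add, ← QuotientAddGroup.mk_add,
      ← QuotientAddGroup.mk_sub, QuotientAddGroup.eq_zero_iff]
    exact AddSubgroup.subset_closure ⟨g, h, k, by abel⟩

/-- The homomorphism out of the universal module classified by a cocycle. -/
def TrivialCocycle.classify {G A : Type*} [Group G] [AddCommGroup A] (c : TrivialCocycle G A) :
    CocycleModule G →+ A :=
  QuotientAddGroup.lift _ (FreeAbelianGroup.lift fun p => c.val p.1 p.2) <| by
    rw [AddSubgroup.closure_le]
    rintro _ ⟨g, h, k, rfl⟩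
    simp [c.cocycle g h k]

lemma TrivialCocycle.classify_val {G A : Type*} [Group G] [AddCommGroup A]
    (c : TrivialCocycle G A) (g h : G) : c.classify ((universalCocycle G).val g h) = c.val g h :=
  FreeAbelianGroup.lift_apply_of _ _

open scoped IsMulCommutative in
/-- A set-theoretic section with central defect defines a cocycle with values in the centre. -/
def centralDefect {G E : Type*} [Group G] [Group E] (s : G → E)
    (hs : ∀ g h, s g * s h * (s (g * h))⁻¹ ∈ Subgroup.center E) :
    TrivialCocycle G (Additive (Subgroup.center E)) where
  val g h := .ofMul ⟨s g * s h * (s (g * h))⁻¹, hs g h⟩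
  cocycle g h k := by
    apply Additive.toMul.injective
    apply Subtype.ext
    have h1 := Subgroup.mem_center_iff.1 (hs h k) (s g)
    simp only [toMul_add, toMul_ofMul, Subgroup.coe_mul, mul_assoc g h k]
    calc _ = s g * (s h * s k * (s (h * k))⁻¹) * s (h * k) * (s (g * (h * k)))⁻¹ := by group
      _ = _ := by rw [h1]; group

open scoped IsMulCommutative in
/-- The universal central extension maps onto `F / [F, R]`, compatibly with the maps from `F`. -/
lemma ker_ofFree_universalCocycle_le (G : Type*) [Group G] :
    (ofFree (universalCocycle G)).ker ≤
      ⁅(⊤ : Subgroup (FreeGroup G)), (FreeGroup.lift (id : G → G)).ker⁆ := by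
  set N := ⁅(⊤ : Subgroup (FreeGroup G)), (FreeGroup.lift (id : G → G)).ker⁆ with hN
  let s : G → FreeGroup G ⧸ N := fun g => QuotientGroup.mk (FreeGroup.of g)
  have hs : ∀ g h, s g * s h * (s (g * h))⁻¹ ∈ Subgroup.center (FreeGroup G ⧸ N) := by
    intro g h
    rw [Subgroup.mem_center_iff]
    intro x
    obtain ⟨w, rfl⟩ := QuotientGroup.mk_surjective x
    have hr : FreeGroup.of g * FreeGroup.of h * (FreeGroup.of (g * h))⁻¹ ∈
        (FreeGroup.lift (id : G → G)).ker := by simp [MonoidHom.mem_ker]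
    have hc := Subgroup.commutator_mem_commutator (Subgroup.mem_top w) hr
    rw [← hN, ← QuotientGroup.eq_one_iff, commutatorElement_def, QuotientGroup.mk_mul,
      QuotientGroup.mk_mul, QuotientGroup.mk_inv, QuotientGroup.mk_inv, mul_inv_eq_one,
      mul_inv_eq_iff_eq_mul, QuotientGroup.mk_mul] at hc
    exact hc
  let d := centralDefect s hs
  let φ : Multiplicative (CocycleModule G) →* FreeGroup G ⧸ N :=
    (Subgroup.center (FreeGroup G ⧸ N)).subtype.comp d.classify.toMultiplicativeLeft
  have hφ : ∀ g h, φ (.ofAdd ((universalCocycle G).val g h)) = s g * s h * (s (g * h))⁻¹ := by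
    intro g h
    have := d.classify_val g h
    simp only [φ, MonoidHom.comp_apply, AddMonoidHom.coe_toMultiplicativeLeft,
      Function.comp_apply, toAdd_ofAdd, this]
    rfl
  have hcentral : ∀ a x, φ a * x = x * φ a := fun a x =>
    (Subgroup.mem_center_iff.1 (d.classify.toMultiplicativeLeft a).2 x).symm
  let Λ : CocycleExtension (universalCocycle G) →* FreeGroup G ⧸ N :=
    lift φ hcentral s fun g h => by
      rw [hφ]
      group
  have hΛ : Λ.comp (ofFree (universalCocycle G)) = QuotientGroup.mk' N := by
    ext g
    change Λ (ofFree (universalCocycle G) (FreeGroup.of g)) = s g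
    rw [ofFree_of, show Λ ⟨0, g⟩ = φ (.ofAdd 0) * s g from rfl, ofAdd_zero, map_one, one_mul]
  intro w hw
  rw [← QuotientGroup.ker_mk' N, MonoidHom.mem_ker, ← hΛ, MonoidHom.comp_apply, hw, map_one]

lemma incl_mem_range_ofFree (G : Type*) [Group G] (a : Multiplicative (CocycleModule G)) :
    incl (universalCocycle G) a ∈ (ofFree (universalCocycle G)).range := by
  obtain ⟨y, hy⟩ := QuotientAddGroup.mk_surjective a.toAdd
  obtain rfl : Multiplicative.ofAdd (QuotientAddGroup.mk y) = a := by rw [hy, ofAdd_toAdd]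
  clear hy
  induction y using FreeAbelianGroup.induction_on with
  | zero => exact ⟨1, by simp⟩
  | of p => exact ⟨_, ofFree_relator (universalCocycle G) p.1 p.2⟩
  | neg p h =>
    rw [QuotientAddGroup.mk_neg, ofAdd_neg, map_inv]
    exact inv_mem h
  | add y z hy hz =>
    rw [QuotientAddGroup.mk_add, ofAdd_add, map_mul]
    exact mul_mem hy hz

lemma ker_ofRelations_universalCocycle (G : Type*) [Group G] :
    (ofRelations (universalCocycle G)).ker =
      ⁅(⊤ : Subgroup (FreeGroup G)), (FreeGroup.lift (id : G → G)).ker⁆.subgroupOf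
        (FreeGroup.lift (id : G → G)).ker := by
  ext r
  rw [MonoidHom.mem_ker, Subgroup.mem_subgroupOf,
    ← (injective_iff_map_eq_one' _).1 (incl_injective (universalCocycle G)), incl_ofRelations]
  refine ⟨fun h => ker_ofFree_universalCocycle_le G h, fun h => ?_⟩
  refine (Subgroup.commutator_le (H₃ := (ofFree (universalCocycle G)).ker)).2 ?_ h
  intro w _ t ht
  rw [MonoidHom.mem_ker, map_commutatorElement, commutatorElement_eq_one_iff_mul_comm,
    ← incl_ofRelations _ ⟨t, ht⟩, incl_central]

lemma mem_commutator_iff_of_relations {G : Type*} [Group G] (ψ : CocycleModule G →+ (G →₀ ℤ))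
    (hψ : ∀ g h : G, ψ ((universalCocycle G).val g h) =
      Finsupp.single g 1 + Finsupp.single h 1 - Finsupp.single (g * h) 1)
    (r : (FreeGroup.lift (id : G → G)).ker) :
    (r : FreeGroup G) ∈ commutator (FreeGroup G) ↔
      ψ (ofRelations (universalCocycle G) r).toAdd = 0 := by
  let Λ : CocycleExtension (universalCocycle G) →* Multiplicative (G →₀ ℤ) :=
    lift ψ.toMultiplicative (fun _ _ => mul_comm _ _) (fun g => .ofAdd (Finsupp.single g 1))
      fun g h => by
        simp [hψ, ← ofAdd_add]
  have hΛ : Λ.comp (ofFree (universalCocycle G)) =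
      FreeGroup.lift fun x => Multiplicative.ofAdd (Finsupp.single x (1 : ℤ)) := by
    ext1 g
    simp [Λ, lift_apply]
  have hincl : ∀ a, Λ (incl (universalCocycle G) a) = .ofAdd (ψ a.toAdd) := by
    intro a
    simp [Λ, lift_apply, incl, hψ]
  rw [mem_commutator_freeGroup_iff, ← hΛ, MonoidHom.comp_apply, ← incl_ofRelations, hincl,
    ofAdd_eq_one]

/-- For a finite group `G`, let `A` be the abelian group generated by
symbols `a(g,h)` with the cocycle relations, and `ψ : A →+ ℤ^G` determined by
`a(g,h) ↦ e_g + e_h − e_{gh}`. Then `ker ψ ≅ ([F,F] ∩ R)/[F,R]`, the Schur multiplier of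
`G` by Hopf's formula. -/
theorem ker_psi_iso_schur_multiplier
    (G : Type u) [Group G] [Finite G] :
    ∀ ψ : (FreeAbelianGroup (G × G) ⧸
        AddSubgroup.closure {x : FreeAbelianGroup (G × G) | ∃ g h k : G,
          x = FreeAbelianGroup.of (g, h) + FreeAbelianGroup.of (g * h, k)
            - FreeAbelianGroup.of (h, k) - FreeAbelianGroup.of (g, h * k)}) →+ (G →₀ ℤ),
      (∀ g h : G,
        ψ (QuotientAddGroup.mk (FreeAbelianGroup.of (g, h))) =
          Finsupp.single g 1 + Finsupp.single h 1 - Finsupp.single (g * h) 1) →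
      Nonempty (ψ.ker ≃+
        Additive
          (↥(commutator (FreeGroup G) ⊓ (FreeGroup.lift (id : G → G)).ker) ⧸
            ((⁅(⊤ : Subgroup (FreeGroup G)), (FreeGroup.lift (id : G → G)).ker⁆).subgroupOf
              (commutator (FreeGroup G) ⊓ (FreeGroup.lift (id : G → G)).ker)))) := by
  intro ψ hψ
  let ρ : ↥(commutator (FreeGroup G) ⊓ (FreeGroup.lift (id : G → G)).ker) →*
      Multiplicative ψ.ker :=
    MonoidHom.mk' (fun r => .ofAdd ⟨(ofRelations (universalCocycle G) ⟨r, r.2.2⟩).toAdd,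
        (mem_commutator_iff_of_relations ψ hψ ⟨r, r.2.2⟩).1 r.2.1⟩) fun r t => by
      rw [← ofAdd_add]
      congr 1
      exact Subtype.ext
        (map_mul (ofRelations (universalCocycle G)) ⟨r, r.2.2⟩ ⟨t, t.2.2⟩)
  have hker : ρ.ker = (⁅(⊤ : Subgroup (FreeGroup G)),
      (FreeGroup.lift (id : G → G)).ker⁆).subgroupOf
        (commutator (FreeGroup G) ⊓ (FreeGroup.lift (id : G → G)).ker) := by
    ext r
    have h := SetLike.ext_iff.1 (ker_ofRelations_universalCocycle G) ⟨r, r.2.2⟩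
    rw [MonoidHom.mem_ker, Subgroup.mem_subgroupOf] at h ⊢
    exact Iff.trans Subtype.ext_iff h
  have hsurj : Function.Surjective ρ := by
    intro a
    obtain ⟨w, hw⟩ := incl_mem_range_ofFree G (.ofAdd a.toAdd.1)
    have hR : w ∈ (FreeGroup.lift (id : G → G)).ker := by
      rw [MonoidHom.mem_ker, ← ofFree_snd (universalCocycle G), hw]
      rfl
    have hval : ofRelations (universalCocycle G) ⟨w, hR⟩ = .ofAdd a.toAdd.1 :=
      incl_injective _ ((incl_ofRelations _ _).trans hw)
    have hC : w ∈ commutator (FreeGroup G) := by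
      rw [mem_commutator_iff_of_relations ψ hψ ⟨w, hR⟩, hval]
      exact a.toAdd.2
    exact ⟨⟨w, hC, hR⟩, Subtype.ext hval⟩
  exact ⟨(MulEquiv.toAdditiveLeft ((QuotientGroup.quotientMulEquivOfEq hker.symm).trans
    (QuotientGroup.quotientKerEquivOfSurjective ρ hsurj))).symm⟩
end
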